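/- arXiv:1203.3306 — 2 statements merged into one kernel-verified Lean document; each statement's English description precedes it below -/
import Mathlib

section
/- Let P be the transition kernel of the simple random walk on the half-plane one-way lattice ℍ and G its Green function. Then for every z ∈ ℤ, the Martin kernel K((z,0), y) = G((z,0), y)/G((0,0), y) tends to 1 as |y₁| + |y₂| → ∞ along y = (y₁,y₂) ∈ ℤ². -/
open Filter

noncomputable section

/-- Transition kernel of the simple random walk on the half-plane one-way lattice ℍ. -/
def halfPlaneKernel : ℤ × ℤ → ℤ × ℤ → ℝ := fun u v =>
  if u.2 ≠ 0 then
    (if v = (u.1, u.2 + 1) then (1 : ℝ) / 3 else 0) +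
    (if v = (u.1, u.2 - 1) then (1 : ℝ) / 3 else 0) +
    (if v = (u.1 + Int.sign u.2, u.2) then (1 : ℝ) / 3 else 0)
  else
    (if v = (u.1, 1) then (1 : ℝ) / 2 else 0) +
    (if v = (u.1, -1) then (1 : ℝ) / 2 else 0)

/-- Powers of the transition kernel. -/
def kernelPow : ℕ → ℤ × ℤ → ℤ × ℤ → ℝ
  | 0, u, v => if u = v then 1 else 0
  | n + 1, u, v => ∑' w : ℤ × ℤ, kernelPow n u w * halfPlaneKernel w v

/-- Green function `G(u,v) = ∑_{n ≥ 0} P^n(u,v)`. -/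
def greenFn (u v : ℤ × ℤ) : ℝ := ∑' n : ℕ, kernelPow n u v

section HelperLemmas

/-- Normalised `n`-step probabilities from the origin. -/
def qn : ℕ → ℤ → ℤ → ℝ
  | 0, a, b => if a = 0 ∧ b = 0 then 1 else 0
  | n + 1, a, b =>
    if b = 0 then (qn n a 1 + qn n a (-1)) / 2
    else (qn n a (b + 1) + qn n a (b - 1) + qn n (a - Int.sign b) b) / 3

/-- Normalising weight. -/
def wt (b : ℤ) : ℝ := if b = 0 then 1 else 3 / 2

lemma wt_pos (b : ℤ) : 0 < wt b := by
  unfold wt; split_ifs <;> norm_num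

lemma kernelPow_eq (z : ℤ) (n : ℕ) : ∀ a b : ℤ,
    kernelPow n (z, 0) (a, b) = wt b * qn n (a - z) b := by
  induction n with
  | zero =>
    intro a b
    simp only [kernelPow, qn, wt, Prod.mk.injEq]
    by_cases h : z = a <;> by_cases hb : b = 0
    · simp [h, hb]
    · simp [h, hb, Ne.symm hb]
    · have : ¬ (a - z = 0) := by omega
      simp [h, hb, this]
    · simp [h, hb, Ne.symm hb]
  | succ n ih =>
    intro a b
    simp only [kernelPow]
    rw [tsum_eq_sum (s := ({(a, b + 1), (a, b - 1), (a - Int.sign b, b)} : Finset (ℤ × ℤ)))]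
    · have hs1 : Int.sign (1 : ℤ) = 1 := rfl
      have hs2 : Int.sign (-1 : ℤ) = -1 := rfl
      rcases lt_trichotomy b 0 with hb | hb | hb
      · have hs : Int.sign b = -1 := Int.sign_eq_neg_one_of_neg hb
        rw [Finset.sum_insert, Finset.sum_insert, Finset.sum_singleton, ih, ih, ih]
        · simp only [halfPlaneKernel, qn, wt, hs, Prod.mk.injEq]
          by_cases hb1 : b = -1
          · subst hb1; simp; ring_nf
          · have h1 : b + 1 ≠ 0 := by omega
            have h2 : b - 1 ≠ 0 := by omega
            have h3 : b ≠ 0 := by omega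
            have h4 : b ≠ b + 1 + 1 := by omega
            have h5 : b ≠ b - 1 - 1 := by omega
            have h6 : b ≠ b - 1 := by omega
            simp [h1, h2, h3, h4, h5, h6, hs]
            ring_nf
        · simp
        · simp [hs]; omega
      · subst hb
        rw [Int.sign_zero]
        rw [Finset.sum_insert, Finset.sum_insert, Finset.sum_singleton, ih, ih, ih]
        · simp [halfPlaneKernel, qn, wt]
          ring_nf
        · simp
        · simp
      · have hs : Int.sign b = 1 := Int.sign_eq_one_of_pos hb
        rw [Finset.sum_insert, Finset.sum_insert, Finset.sum_singleton, ih, ih, ih]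
        · simp only [halfPlaneKernel, qn, wt, hs, Prod.mk.injEq]
          by_cases hb1 : b = 1
          · subst hb1; simp; ring_nf
          · have h1 : b + 1 ≠ 0 := by omega
            have h2 : b - 1 ≠ 0 := by omega
            have h3 : b ≠ 0 := by omega
            have h4 : b ≠ b + 1 + 1 := by omega
            have h5 : b ≠ b - 1 - 1 := by omega
            have h6 : b ≠ b - 1 := by omega
            simp [h1, h2, h3, h4, h5, h6, hs]
            ring_nf
        · simp
        · simp [hs]; omega
    · rintro ⟨x, y⟩ hxy
      simp only [Finset.mem_insert, Finset.mem_singleton, Prod.mk.injEq, not_or] at hxy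
      obtain ⟨h1, h2, h3⟩ := hxy
      have : halfPlaneKernel (x, y) (a, b) = 0 := by
        unfold halfPlaneKernel
        simp only [Prod.mk.injEq]
        by_cases hy : y = 0
        · subst hy
          have e1 : ¬ (a = x ∧ b = 1) := by rintro ⟨rfl, rfl⟩; exact h2 ⟨rfl, rfl⟩
          have e2 : ¬ (a = x ∧ b = -1) := by rintro ⟨rfl, rfl⟩; exact h1 ⟨rfl, rfl⟩
          simp [e1, e2]
        · have e1 : ¬ (a = x ∧ b = y + 1) := by rintro ⟨rfl, rfl⟩; exact h2 ⟨rfl, by ring⟩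
          have e2 : ¬ (a = x ∧ b = y - 1) := by rintro ⟨rfl, rfl⟩; exact h1 ⟨rfl, by ring⟩
          have e3 : ¬ (a = x + Int.sign y ∧ b = y) := by
            rintro ⟨rfl, rfl⟩; exact h3 ⟨by ring, rfl⟩
          simp [hy, e1, e2, e3]
      rw [this, mul_zero]

lemma qn_nonneg (n : ℕ) : ∀ a b, 0 ≤ qn n a b := by
  induction n with
  | zero => intro a b; simp only [qn]; split_ifs <;> norm_num
  | succ n ih =>
    intro a b
    simp only [qn]
    split_ifs
    · have := ih a 1; have := ih a (-1); positivity
    · have := ih a (b + 1); have := ih a (b - 1); have := ih (a - Int.sign b) b; positivity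

lemma qn_le_one (n : ℕ) : ∀ a b, qn n a b ≤ 1 := by
  induction n with
  | zero => intro a b; simp only [qn]; split_ifs <;> norm_num
  | succ n ih =>
    intro a b
    simp only [qn]
    split_ifs
    · have := ih a 1; have := ih a (-1); linarith
    · have := ih a (b + 1); have := ih a (b - 1); have := ih (a - Int.sign b) b; linarith

lemma qn_symm (n : ℕ) : ∀ a b, qn n (-a) (-b) = qn n a b := by
  induction n with
  | zero => intro a b; simp only [qn, neg_eq_zero]
  | succ n ih =>
    intro a b
    simp only [qn, neg_eq_zero]
    have e1 := ih a 1
    have e2 := ih a (-1)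
    have e3 := ih a (b + 1)
    have e4 := ih a (b - 1)
    have e5 := ih (a - Int.sign b) b
    rw [Int.sign_neg]
    rw [neg_neg] at e2
    rw [show -b + 1 = -(b - 1) by ring, show -b - 1 = -(b + 1) by ring,
      show -a - -Int.sign b = -(a - Int.sign b) by ring, e1, e2, e3, e4, e5]
    split_ifs <;> ring

/-- Discounted normalised Green function. -/
def Vs (s : ℝ) (a b : ℤ) : ℝ := ∑' n : ℕ, s ^ n * qn n a b

lemma Vs_summable {s : ℝ} (h0 : 0 ≤ s) (h1 : s < 1) (a b : ℤ) :
    Summable (fun n : ℕ => s ^ n * qn n a b) := by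
  refine Summable.of_nonneg_of_le (fun n => mul_nonneg (pow_nonneg h0 n) (qn_nonneg n a b))
    (fun n => ?_) (summable_geometric_of_lt_one h0 h1)
  exact mul_le_of_le_one_right (pow_nonneg h0 n) (qn_le_one n a b)

lemma Vs_nonneg {s : ℝ} (h0 : 0 ≤ s) (a b : ℤ) : 0 ≤ Vs s a b :=
  tsum_nonneg (fun n => mul_nonneg (pow_nonneg h0 n) (qn_nonneg n a b))

lemma Vs_bdd {s : ℝ} (h0 : 0 ≤ s) (h1 : s < 1) (a b : ℤ) : Vs s a b ≤ (1 - s)⁻¹ := by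
  rw [← tsum_geometric_of_lt_one h0 h1]
  refine (Vs_summable h0 h1 a b).tsum_le_tsum (fun n => ?_) (summable_geometric_of_lt_one h0 h1)
  exact mul_le_of_le_one_right (pow_nonneg h0 n) (qn_le_one n a b)

lemma Vs_rec_zero {s : ℝ} (h0 : 0 ≤ s) (h1 : s < 1) (a : ℤ) :
    Vs s a 0 = (if a = 0 then 1 else 0) + s * ((Vs s a 1 + Vs s a (-1)) / 2) := by
  have A := Vs_summable h0 h1 a 1
  have B := Vs_summable h0 h1 a (-1)
  unfold Vs
  rw [(Vs_summable h0 h1 a 0).tsum_eq_zero_add, ← A.tsum_add B, ← tsum_div_const, ← tsum_mul_left]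
  congr 1
  · simp [qn]
  · apply tsum_congr; intro n; simp [qn, pow_succ]; ring

lemma Vs_rec {s : ℝ} (h0 : 0 ≤ s) (h1 : s < 1) (a b : ℤ) (hb : b ≠ 0) :
    Vs s a b = s * ((Vs s a (b + 1) + Vs s a (b - 1) + Vs s (a - Int.sign b) b) / 3) := by
  have A := Vs_summable h0 h1 a (b + 1)
  have B := Vs_summable h0 h1 a (b - 1)
  have C := Vs_summable h0 h1 (a - Int.sign b) b
  unfold Vs
  rw [(Vs_summable h0 h1 a b).tsum_eq_zero_add, ← A.tsum_add B, ← (A.add B).tsum_add C,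
    ← tsum_div_const, ← tsum_mul_left]
  have : s ^ 0 * qn 0 a b = 0 := by simp [qn, hb]
  rw [this, zero_add]
  apply tsum_congr; intro n; simp [qn, hb, pow_succ]; ring

lemma exists_small_root {κ : ℝ} (hκ : 0 < κ) {w : ℂ} (hw : ‖w‖ = 1) :
    ∃ F : ℂ, F ^ 2 - (3 + κ - w) * F + 1 = 0 ∧ ‖F‖ < 1 := by
  set c : ℂ := 3 + κ - w with hc
  obtain ⟨r, hr⟩ := IsAlgClosed.exists_pow_nat_eq (c ^ 2 - 4) (n := 2) (by norm_num)
  have hroot : ∀ F : ℂ, F ^ 2 - c * F + 1 = 0 → ‖F‖ ≠ 1 := by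
    intro F hF h1
    have hF0 : F ≠ 0 := by rintro rfl; simp at h1
    have hcF : c = F + F⁻¹ := by field_simp; linear_combination -hF
    have : ‖c‖ ≤ 2 := by
      rw [hcF]; refine (norm_add_le _ _).trans ?_
      rw [norm_inv, h1]; norm_num
    have h2 : c.re ≤ 2 := (Complex.re_le_norm c).trans this
    have h3 : c.re = 3 + κ - w.re := by simp [hc]
    have h4 : w.re ≤ 1 := hw ▸ Complex.re_le_norm w
    linarith
  have r1 : ((c + r) / 2) ^ 2 - c * ((c + r) / 2) + 1 = 0 := by linear_combination hr / 4
  have r2 : ((c - r) / 2) ^ 2 - c * ((c - r) / 2) + 1 = 0 := by linear_combination hr / 4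
  have hp : ((c + r) / 2) * ((c - r) / 2) = 1 := by linear_combination -hr / 4
  rcases lt_or_gt_of_ne (hroot _ r1) with h | h
  · exact ⟨_, r1, h⟩
  · refine ⟨_, r2, ?_⟩
    have hn := congrArg norm hp
    rw [norm_mul, norm_one] at hn
    by_contra hcon
    push Not at hcon
    have := norm_nonneg ((c - r) / 2)
    nlinarith

/-- Root of the quadratic on the unit circle. -/
def Fk (κ θ : ℝ) : ℂ :=
  if h : 0 < κ then
    Classical.choose (exists_small_root h (w := Complex.exp (θ * Complex.I))
      (Complex.norm_exp_ofReal_mul_I θ))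
  else 0

lemma Fk_root {κ : ℝ} (h : 0 < κ) (θ : ℝ) :
    (Fk κ θ) ^ 2 - (3 + κ - Complex.exp (θ * Complex.I)) * Fk κ θ + 1 = 0 := by
  unfold Fk; rw [dif_pos h]
  exact (Classical.choose_spec (exists_small_root h (w := Complex.exp (θ * Complex.I))
      (Complex.norm_exp_ofReal_mul_I θ))).1

lemma Fk_norm {κ : ℝ} (h : 0 < κ) (θ : ℝ) : ‖Fk κ θ‖ < 1 := by
  unfold Fk; rw [dif_pos h]
  exact (Classical.choose_spec (exists_small_root h (w := Complex.exp (θ * Complex.I))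
      (Complex.norm_exp_ofReal_mul_I θ))).2

/-- All pointwise bounds on the root. -/
lemma root_bounds {κ : ℝ} (hκ : 0 < κ) (hκ1 : κ ≤ 1) {w F : ℂ} (hw : ‖w‖ = 1)
    (hF : F ^ 2 - (3 + κ - w) * F + 1 = 0) (hF1 : ‖F‖ < 1) :
    0 < 1 - F.re ∧ 1 - F.re ≤ 1 ∧ ‖F‖ * (1 + (1 - F.re)) ≤ 1 ∧
    ‖1 - w‖ ≤ 12 * (1 - F.re) ^ 2 ∧ (1 - F.re) ^ 2 ≤ κ + ‖1 - w‖ := by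
  have hq : (1 - F) ^ 2 = F * (κ + 1 - w) := by linear_combination hF
  have hwre : w.re ≤ 1 := hw ▸ Complex.re_le_norm w
  have hx : 0 < 1 - F.re := by have := Complex.re_le_norm F; linarith
  have hre := congrArg Complex.re hq
  have him := congrArg Complex.im hq
  simp [pow_two] at hre him
  set p := F.re with hp
  set y := F.im with hy
  set x := 1 - p with hxdef
  have hp' : p = 1 - x := by rw [hxdef]; ring
  have key : (1 - x) * (x ^ 2 - y ^ 2) - 2 * x * y ^ 2 = (p ^ 2 + y ^ 2) * (κ + 1 - w.re) := by
    have : p * (x * x - y * y) + y * (-(x * y) + -(y * x)) = (p ^ 2 + y ^ 2) * (κ + 1 - w.re) := by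
      linear_combination p * hre + y * him
    rw [← this, hp']; ring
  have key2 : y ^ 2 * (1 + x) ≤ x ^ 2 * (1 - x) := by
    have : 0 ≤ (p ^ 2 + y ^ 2) * (κ + 1 - w.re) := by
      apply mul_nonneg (by positivity); linarith
    nlinarith
  have hx1 : x ≤ 1 := by
    by_contra hcon
    push Not at hcon
    have : 0 ≤ y ^ 2 * (1 + x) := by positivity
    nlinarith [pow_pos hx 2]
  have hyx : y ^ 2 ≤ x ^ 2 := by nlinarith [sq_nonneg y, sq_nonneg x]
  have nF : ‖F‖ ^ 2 = p ^ 2 + y ^ 2 := by rw [Complex.sq_norm, Complex.normSq_apply]; ring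
  have nA : ‖1 - F‖ ^ 2 = x ^ 2 + y ^ 2 := by
    rw [Complex.sq_norm, Complex.normSq_apply]; simp [← hp, ← hy]; ring
  have b1 : ‖F‖ * (1 + x) ≤ 1 := by
    have : (‖F‖ * (1 + x)) ^ 2 ≤ 1 := by
      rw [mul_pow, nF, hp']
      nlinarith [mul_le_mul_of_nonneg_left key2 (show 0 ≤ 1 + x by linarith), sq_nonneg x]
    exact (sq_le_one_iff₀ (by positivity)).1 this
  have inv : 1 ≤ 6 * ‖F‖ := by
    have e : F * (3 + κ - w - F) = 1 := by linear_combination -hF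
    have e' := congrArg norm e
    rw [norm_mul, norm_one] at e'
    have : ‖3 + (κ : ℂ) - w - F‖ ≤ 6 := by
      refine (norm_sub_le _ _).trans ?_
      have h1 := norm_sub_le (3 + (κ : ℂ)) w
      have h2 : ‖3 + (κ : ℂ)‖ ≤ 4 := by
        refine (norm_add_le _ _).trans ?_
        rw [Complex.norm_real, Real.norm_of_nonneg hκ.le]; norm_num; linarith
      linarith
    nlinarith [norm_nonneg F]
  have qn : ‖F‖ * ‖(κ : ℂ) + 1 - w‖ = ‖1 - F‖ ^ 2 := by
    rw [← norm_mul, ← hq, norm_pow]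
  have hwq : ‖1 - w‖ ≤ ‖(κ : ℂ) + 1 - w‖ := by
    apply (sq_le_sq₀ (norm_nonneg _) (norm_nonneg _)).1
    rw [Complex.sq_norm, Complex.sq_norm, Complex.normSq_apply, Complex.normSq_apply]
    simp
    nlinarith
  have hqw : ‖(κ : ℂ) + 1 - w‖ ≤ κ + ‖1 - w‖ := by
    rw [add_sub_assoc]
    refine (norm_add_le _ _).trans ?_
    rw [Complex.norm_real, Real.norm_of_nonneg hκ.le]
  refine ⟨hx, hx1, b1, ?_, ?_⟩
  · have := norm_nonneg ((κ : ℂ) + 1 - w)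
    nlinarith
  · have := norm_nonneg ((κ : ℂ) + 1 - w)
    nlinarith [sq_nonneg y]

lemma Fk_bounds {κ : ℝ} (hκ : 0 < κ) (hκ1 : κ ≤ 1) (θ : ℝ) :
    0 < 1 - (Fk κ θ).re ∧ 1 - (Fk κ θ).re ≤ 1 ∧ ‖Fk κ θ‖ * (1 + (1 - (Fk κ θ).re)) ≤ 1 ∧
    ‖1 - Complex.exp (θ * Complex.I)‖ ≤ 12 * (1 - (Fk κ θ).re) ^ 2 ∧
    (1 - (Fk κ θ).re) ^ 2 ≤ κ + ‖1 - Complex.exp (θ * Complex.I)‖ :=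
  root_bounds hκ hκ1 (Complex.norm_exp_ofReal_mul_I θ) (Fk_root hκ θ) (Fk_norm hκ θ)

lemma Fk_periodic {κ : ℝ} : Fk κ (-Real.pi) = Fk κ Real.pi := by
  have : Complex.exp ((-Real.pi : ℝ) * Complex.I) = Complex.exp ((Real.pi : ℝ) * Complex.I) := by
    rw [Complex.ofReal_neg, neg_mul, Complex.exp_neg, Complex.exp_pi_mul_I]; norm_num
  unfold Fk
  simp only [this]

lemma Fk_ne_one {κ : ℝ} (h : 0 < κ) (θ φ : ℝ) : 1 - Fk κ θ * Fk κ φ ≠ 0 := by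
  intro h0
  have h1 : Fk κ θ * Fk κ φ = 1 := by linear_combination -h0
  have := congrArg norm h1
  rw [norm_mul, norm_one] at this
  have a := Fk_norm h θ
  have b := Fk_norm h φ
  nlinarith [norm_nonneg (Fk κ θ), norm_nonneg (Fk κ φ)]

lemma Fk_diff {κ : ℝ} (h : 0 < κ) (θ φ : ℝ) :
    (Fk κ φ - Fk κ θ) = (Complex.exp (φ * Complex.I) - Complex.exp (θ * Complex.I)) *
      (Fk κ θ * Fk κ φ / (1 - Fk κ θ * Fk κ φ)) := by
  have hne := Fk_ne_one h θ φ
  have a := Fk_root h θ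
  have b := Fk_root h φ
  rw [← mul_div_assoc, eq_div_iff hne]
  linear_combination Fk κ φ * a - Fk κ θ * b

lemma Fk_continuous {κ : ℝ} (h : 0 < κ) : Continuous (Fk κ) := by
  rw [continuous_iff_continuousAt]
  intro θ
  rw [ContinuousAt, tendsto_iff_norm_sub_tendsto_zero]
  have hlim : Tendsto (fun φ : ℝ =>
      ‖Complex.exp (φ * Complex.I) - Complex.exp (θ * Complex.I)‖ * (1 / (1 - ‖Fk κ θ‖)))
      (nhds θ) (nhds 0) := by
    have : Continuous (fun φ : ℝ =>
      ‖Complex.exp (φ * Complex.I) - Complex.exp (θ * Complex.I)‖ * (1 / (1 - ‖Fk κ θ‖))) := by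
      fun_prop
    have := this.tendsto θ
    simpa using this
  refine squeeze_zero (fun _ => norm_nonneg _) (fun φ => ?_) hlim
  rw [Fk_diff h θ φ, norm_mul]
  apply mul_le_mul_of_nonneg_left _ (norm_nonneg _)
  have a := Fk_norm h θ
  have b := Fk_norm h φ
  rw [norm_div, norm_mul]
  apply div_le_div₀ (by norm_num)
  · nlinarith [norm_nonneg (Fk κ θ), norm_nonneg (Fk κ φ)]
  · linarith
  · have := norm_sub_norm_le (1 : ℂ) (Fk κ θ * Fk κ φ)
    rw [norm_one, norm_mul] at this
    nlinarith [norm_nonneg (Fk κ θ), norm_nonneg (Fk κ φ)]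

/-- The derivative of the root along the circle. -/
def Fk' (κ θ : ℝ) : ℂ :=
  Complex.exp (θ * Complex.I) * Complex.I * (Fk κ θ * Fk κ θ / (1 - Fk κ θ * Fk κ θ))

lemma Fk_hasDerivAt {κ : ℝ} (h : 0 < κ) (θ : ℝ) : HasDerivAt (Fk κ) (Fk' κ θ) θ := by
  rw [hasDerivAt_iff_tendsto_slope]
  have he : HasDerivAt (fun φ : ℝ => Complex.exp (φ * Complex.I))
      (Complex.exp (θ * Complex.I) * Complex.I) θ := by
    have := ((Complex.ofRealCLM.hasDerivAt (x := θ)).mul_const Complex.I).cexp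
    simpa using this
  rw [hasDerivAt_iff_tendsto_slope] at he
  have hc : Tendsto (fun φ => Fk κ θ * Fk κ φ / (1 - Fk κ θ * Fk κ φ)) (nhdsWithin θ {θ}ᶜ)
      (nhds (Fk κ θ * Fk κ θ / (1 - Fk κ θ * Fk κ θ))) := by
    have hF := Fk_continuous h
    have : Continuous (fun φ => Fk κ θ * Fk κ φ / (1 - Fk κ θ * Fk κ φ)) :=
      (continuous_const.mul hF).div (continuous_const.sub (continuous_const.mul hF))
        (fun φ => Fk_ne_one h θ φ)
    exact (this.tendsto θ).mono_left nhdsWithin_le_nhds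
  refine (he.mul hc).congr (fun φ => ?_)
  rw [slope_def_module, slope_def_module, Fk_diff h θ φ, smul_mul_assoc]

lemma Fk'_continuous {κ : ℝ} (h : 0 < κ) : Continuous (Fk' κ) := by
  have hF := Fk_continuous h
  unfold Fk'
  exact Continuous.mul (by fun_prop) ((hF.mul hF).div (continuous_const.sub (hF.mul hF))
        (fun φ => Fk_ne_one h φ φ))

lemma Fk'_bound {κ : ℝ} (hκ : 0 < κ) (hκ1 : κ ≤ 1) (θ : ℝ) :
    ‖Fk' κ θ‖ * (1 - (Fk κ θ).re) ≤ ‖Fk κ θ‖ := by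
  obtain ⟨h1, h2, -, -, -⟩ := Fk_bounds hκ hκ1 θ
  have hn := Fk_norm hκ θ
  have hne := Fk_ne_one hκ θ θ
  have e : 1 - Fk κ θ * Fk κ θ = (1 - Fk κ θ) * (1 + Fk κ θ) := by ring
  unfold Fk'
  rw [norm_mul, norm_mul, Complex.norm_exp_ofReal_mul_I, Complex.norm_I, norm_div, norm_mul]
  have hpos : 0 < ‖1 - Fk κ θ * Fk κ θ‖ := norm_pos_iff.2 hne
  rw [mul_one, one_mul, div_mul_eq_mul_div, div_le_iff₀ hpos, e, norm_mul]
  have a1 : 1 - (Fk κ θ).re ≤ ‖1 - Fk κ θ‖ := by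
    have := Complex.re_le_norm (1 - Fk κ θ); simpa using this
  have a2 : 1 ≤ ‖1 + Fk κ θ‖ := by
    have := Complex.re_le_norm (1 + Fk κ θ); simp at this; linarith
  have a3 : 1 - (Fk κ θ).re ≤ ‖1 - Fk κ θ‖ * ‖1 + Fk κ θ‖ := by
    nlinarith [norm_nonneg (1 - Fk κ θ)]
  have := norm_nonneg (Fk κ θ)
  rw [mul_assoc]
  apply mul_le_mul_of_nonneg_left _ this
  nlinarith

open MeasureTheory

lemma jint : IntervalIntegrable (fun θ : ℝ => |θ| ^ (-(1 / 2) : ℝ)) volume (-Real.pi) Real.pi := by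
  have h1 : IntervalIntegrable (fun θ : ℝ => |θ| ^ (-(1 / 2) : ℝ)) volume 0 Real.pi := by
    refine IntervalIntegrable.congr ?_
      (intervalIntegral.intervalIntegrable_rpow' (r := (-(1 / 2) : ℝ)) (by norm_num))
    intro x hx
    rw [Set.uIoc_of_le Real.pi_pos.le] at hx
    simp only [abs_of_pos hx.1]
  have h2 := (IntervalIntegrable.iff_comp_neg (by finiteness)).1 h1
  simp only [abs_neg, neg_zero] at h2
  exact h2.symm.trans h1

/-- A fixed upper bound for the relevant integrals. -/
def J0 : ℝ := ∫ θ in (-Real.pi)..Real.pi, |θ| ^ (-(1 / 2) : ℝ)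

lemma J0_nonneg : 0 ≤ J0 := by
  apply intervalIntegral.integral_nonneg (by linarith [Real.pi_pos])
  intro θ _
  positivity

lemma inv_x_le {κ : ℝ} (hκ : 0 < κ) (hκ1 : κ ≤ 1) {θ : ℝ} (hθ : |θ| ≤ Real.pi) (h0 : θ ≠ 0) :
    1 / (1 - (Fk κ θ).re) ≤ 5 * |θ| ^ (-(1 / 2) : ℝ) := by
  obtain ⟨h1, -, -, h4, -⟩ := Fk_bounds hκ hκ1 θ
  set x := 1 - (Fk κ θ).re
  have hn : 2 / Real.pi * |θ| ≤ ‖1 - Complex.exp (θ * Complex.I)‖ := by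
    rw [norm_sub_rev, mul_comm (θ : ℂ), Complex.norm_exp_I_mul_ofReal_sub_one, norm_mul]
    have := Real.mul_abs_le_abs_sin (x := θ / 2) (by rw [abs_div, abs_two]; linarith)
    rw [abs_div, abs_two] at this
    rw [Real.norm_eq_abs, Real.norm_eq_abs, abs_two]
    linarith
  have hp : 0 < |θ| := abs_pos.2 h0
  rw [Real.rpow_neg hp.le, ← Real.sqrt_eq_rpow]
  have hs : 0 < √|θ| := Real.sqrt_pos.2 hp
  rw [← div_eq_mul_inv, div_le_div_iff₀ h1 hs]
  have hpi := Real.pi_lt_d2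
  have h5 : |θ| ≤ 25 * x ^ 2 := by
    have h6 : 2 / Real.pi * |θ| ≤ 12 * x ^ 2 := hn.trans h4
    have h7 : 2 / 3.15 ≤ 2 / Real.pi := div_le_div_of_nonneg_left (by norm_num) Real.pi_pos hpi.le
    have h8 : 2 / 3.15 * |θ| ≤ 12 * x ^ 2 := (mul_le_mul_of_nonneg_right h7 hp.le).trans h6
    nlinarith
  rw [one_mul]
  exact Real.sqrt_le_iff.2 ⟨by positivity, by nlinarith⟩

/-- Bounding integrals by `J0`. -/
lemma norm_int_le {κ : ℝ} (hκ : 0 < κ) (hκ1 : κ ≤ 1) {f : ℝ → ℂ} {C : ℝ} (hC : 0 ≤ C)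
    (hf : ∀ θ, ‖f θ‖ ≤ C * (1 / (1 - (Fk κ θ).re))) :
    ‖∫ θ in (-Real.pi)..Real.pi, f θ‖ ≤ C * 5 * J0 := by
  have hle : -Real.pi ≤ Real.pi := by linarith [Real.pi_pos]
  unfold J0
  rw [← intervalIntegral.integral_const_mul]
  apply intervalIntegral.norm_integral_le_of_norm_le hle _ (jint.const_mul _)
  have h0 : ∀ᵐ θ : ℝ, θ ≠ 0 := by
    rw [ae_iff]; simp
  filter_upwards [h0] with θ hθ hmem
  refine (hf θ).trans ?_
  rw [mul_assoc]
  exact mul_le_mul_of_nonneg_left (inv_x_le hκ hκ1 (abs_le.2 ⟨hmem.1.le, hmem.2⟩) hθ) hC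

/-- discount parameter -/
def sk (κ : ℝ) : ℝ := 3 / (3 + κ)

lemma sk_pos {κ : ℝ} (hκ : 0 < κ) : 0 < sk κ := by unfold sk; positivity
lemma sk_lt {κ : ℝ} (hκ : 0 < κ) : sk κ < 1 := by
  unfold sk; rw [div_lt_one (by positivity)]; linarith
lemma sk_ge {κ : ℝ} (hκ : 0 < κ) (h1 : κ ≤ 1) : 3 / 4 ≤ sk κ := by
  unfold sk; apply div_le_div_of_nonneg_left <;> linarith
lemma sk_ge' {κ : ℝ} (hκ : 0 < κ) : 1 - κ ≤ sk κ := by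
  unfold sk; rw [le_div_iff₀ (by positivity)]; nlinarith

/-- the symbol on the axis -/
def Qk (κ θ : ℝ) : ℝ := 1 / (1 - sk κ * (Fk κ θ).re)

lemma Qden_pos {κ : ℝ} (hκ : 0 < κ) (θ : ℝ) : 1 - sk κ ≤ 1 - sk κ * (Fk κ θ).re := by
  have h1 := sk_pos hκ
  have := (Complex.re_le_norm (Fk κ θ)).trans (Fk_norm hκ θ).le
  nlinarith

lemma Qden_ne {κ : ℝ} (hκ : 0 < κ) (θ : ℝ) : 1 - sk κ * (Fk κ θ).re ≠ 0 := by
  have := Qden_pos hκ θ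
  have := sk_lt hκ
  linarith

lemma Qk_pos {κ : ℝ} (hκ : 0 < κ) (θ : ℝ) : 0 < Qk κ θ := by
  have := Qden_pos hκ θ
  have := sk_lt hκ
  unfold Qk
  apply one_div_pos.2; linarith

lemma Qk_le {κ : ℝ} (hκ : 0 < κ) (h1 : κ ≤ 1) (θ : ℝ) :
    Qk κ θ ≤ 4 / 3 * (1 / (1 - (Fk κ θ).re)) := by
  obtain ⟨hx, -, -, -, -⟩ := Fk_bounds hκ h1 θ
  have := Qden_pos hκ θ
  have a := sk_lt hκ
  have b := sk_ge hκ h1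
  unfold Qk
  rw [mul_one_div, div_le_div_iff₀ (by linarith) hx]
  nlinarith

lemma Qk_le' {κ : ℝ} (hκ : 0 < κ) (θ : ℝ) : Qk κ θ ≤ 1 / (1 - sk κ) := by
  have := Qden_pos hκ θ
  have a := sk_lt hκ
  unfold Qk
  exact one_div_le_one_div_of_le (by linarith) this

lemma Qk_continuous {κ : ℝ} (hκ : 0 < κ) : Continuous (Qk κ) := by
  have hF := Fk_continuous hκ
  unfold Qk
  exact continuous_const.div (continuous_const.sub (continuous_const.mul
    (Complex.continuous_re.comp hF))) (Qden_ne hκ)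

lemma Qk_ge {κ : ℝ} (hκ : 0 < κ) (hκ1 : κ ≤ 1) {N : ℝ} (hN : 1 ≤ N) (hκN : κ ≤ 1 / N)
    {θ : ℝ} (hθ : |θ| ≤ 1 / N) :
    √N / 3 ≤ Qk κ θ := by
  obtain ⟨h1, h2, -, -, h5⟩ := Fk_bounds hκ hκ1 θ
  set x := 1 - (Fk κ θ).re with hx
  have hn : ‖1 - Complex.exp (θ * Complex.I)‖ ≤ 1 / N := by
    rw [norm_sub_rev, mul_comm (θ : ℂ)]
    refine (Real.norm_exp_I_mul_ofReal_sub_one_le).trans ?_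
    simpa using hθ
  have hNpos : 0 < √N := Real.sqrt_pos.2 (by linarith)
  have hsq : √N * √N = N := Real.mul_self_sqrt (by linarith)
  have hs1 : 1 ≤ √N := Real.one_le_sqrt.2 hN
  have hinv : 1 / N = (1 / √N) * (1 / √N) := by rw [← hsq]; field_simp; rw [Real.sqrt_sq (by positivity)]
  have hi1 : 1 / √N ≤ 1 := by rw [div_le_one hNpos]; exact hs1
  have hi0 : 0 < 1 / √N := by positivity
  have hx2 : x ≤ 2 * (1 / √N) := by
    have : x ^ 2 ≤ (2 * (1 / √N)) ^ 2 := by nlinarith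
    exact (sq_le_sq₀ h1.le (by positivity)).1 this
  have hden : 1 - sk κ * (Fk κ θ).re ≤ 3 * (1 / √N) := by
    have e : (Fk κ θ).re = 1 - x := by rw [hx]; ring
    rw [e]
    have a := sk_lt hκ
    have b := sk_ge' hκ
    nlinarith
  unfold Qk
  have := Qden_pos hκ θ
  have a := sk_lt hκ
  have e : √N / 3 = 1 / (3 * (1 / √N)) := by field_simp
  rw [e]
  exact one_div_le_one_div_of_le (by linarith) hden

open MeasureTheory

/-- powers of the root -/
def Ek (κ : ℝ) (b : ℤ) (θ : ℝ) : ℂ :=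
  if 0 ≤ b then (Fk κ θ) ^ b.toNat else ((starRingEnd ℂ) (Fk κ θ)) ^ (-b).toNat

lemma Ek_nat (κ : ℝ) (n : ℕ) (θ : ℝ) : Ek κ n θ = (Fk κ θ) ^ n := by simp [Ek]

lemma Ek_neg (κ : ℝ) (n : ℕ) (θ : ℝ) : Ek κ (-(n : ℤ)) θ = ((starRingEnd ℂ) (Fk κ θ)) ^ n := by
  unfold Ek
  split_ifs with h
  · have : n = 0 := by omega
    subst this; simp
  · simp

lemma Ek_continuous {κ : ℝ} (hκ : 0 < κ) (b : ℤ) : Continuous (Ek κ b) := by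
  have hF := Fk_continuous hκ
  unfold Ek
  split_ifs
  · exact hF.pow _
  · exact (Complex.continuous_conj.comp hF).pow _

lemma Ek_norm {κ : ℝ} (hκ : 0 < κ) (b : ℤ) (θ : ℝ) : ‖Ek κ b θ‖ ≤ 1 := by
  have := (Fk_norm hκ θ).le
  unfold Ek
  split_ifs
  · rw [norm_pow]; exact pow_le_one₀ (norm_nonneg _) this
  · rw [norm_pow, RCLike.norm_conj]; exact pow_le_one₀ (norm_nonneg _) this

/-- integrand -/
def Ik (κ : ℝ) (a b : ℤ) (θ : ℝ) : ℂ :=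
  Complex.exp (((-a : ℤ) * θ : ℝ) * Complex.I) * Ek κ b θ * (Qk κ θ : ℂ)

lemma Ik_continuous {κ : ℝ} (hκ : 0 < κ) (a b : ℤ) : Continuous (Ik κ a b) := by
  have h1 := Ek_continuous hκ b
  have h2 := Qk_continuous hκ
  unfold Ik
  fun_prop

lemma Ik_int {κ : ℝ} (hκ : 0 < κ) (a b : ℤ) (x y : ℝ) :
    IntervalIntegrable (Ik κ a b) volume x y := (Ik_continuous hκ a b).intervalIntegrable _ _

lemma Ik_norm {κ : ℝ} (hκ : 0 < κ) (a b : ℤ) (θ : ℝ) : ‖Ik κ a b θ‖ ≤ Qk κ θ := by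
  unfold Ik
  rw [norm_mul, norm_mul, Complex.norm_exp_ofReal_mul_I, Complex.norm_real,
    Real.norm_of_nonneg (Qk_pos hκ θ).le, one_mul]
  exact mul_le_of_le_one_left (Qk_pos hκ θ).le (Ek_norm hκ b θ)

/-- Fourier integral -/
def Uk (κ : ℝ) (a b : ℤ) : ℂ := (2 * Real.pi : ℝ)⁻¹ * ∫ θ in (-Real.pi)..Real.pi, Ik κ a b θ

lemma sk_root {κ : ℝ} (hκ : 0 < κ) (θ : ℝ) :
    3 * Fk κ θ = sk κ * ((Fk κ θ) ^ 2 + 1 + Complex.exp (θ * Complex.I) * Fk κ θ) := by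
  have h := Fk_root hκ θ
  have e : (sk κ : ℂ) * (3 + κ) = 3 := by
    unfold sk; push_cast
    have : (3 + κ : ℂ) ≠ 0 := by
      have : (3 + κ : ℝ) ≠ 0 := by positivity
      exact_mod_cast this
    field_simp
  linear_combination (-(Fk κ θ)) * e - sk κ * h

lemma exp_shift (a : ℤ) (θ : ℝ) :
    Complex.exp (((-(a - 1) : ℤ) * θ : ℝ) * Complex.I) =
      Complex.exp (θ * Complex.I) * Complex.exp (((-a : ℤ) * θ : ℝ) * Complex.I) := by
  rw [← Complex.exp_add]; congr 1; push_cast; ring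

lemma exp_shift' (a : ℤ) (θ : ℝ) :
    Complex.exp (((-(a + 1) : ℤ) * θ : ℝ) * Complex.I) =
      (starRingEnd ℂ) (Complex.exp (θ * Complex.I)) *
        Complex.exp (((-a : ℤ) * θ : ℝ) * Complex.I) := by
  rw [← Complex.exp_conj, ← Complex.exp_add]; congr 1; simp; ring

lemma Ik_rec {κ : ℝ} (hκ : 0 < κ) (a b : ℤ) (hb : b ≠ 0) (θ : ℝ) :
    sk κ / 3 * (Ik κ a (b + 1) θ + Ik κ a (b - 1) θ + Ik κ (a - Int.sign b) b θ) = Ik κ a b θ := by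
  have hr := sk_root hκ θ
  rcases lt_or_gt_of_ne hb with h | h
  · rw [Int.sign_eq_neg_one_of_neg h, sub_neg_eq_add]
    obtain ⟨n, rfl⟩ : ∃ n : ℕ, b = -((n + 1 : ℕ) : ℤ) := ⟨(-b).toNat - 1, by omega⟩
    have e1 : -((n + 1 : ℕ) : ℤ) + 1 = -(n : ℤ) := by push_cast; ring
    have e2 : -((n + 1 : ℕ) : ℤ) - 1 = -((n + 2 : ℕ) : ℤ) := by push_cast; ring
    unfold Ik
    rw [e1, e2, Ek_neg, Ek_neg, Ek_neg, exp_shift']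
    have hr' := congrArg (starRingEnd ℂ) hr
    simp only [map_mul, map_add, map_pow, map_one, Complex.conj_ofReal] at hr'
    have h3 : (starRingEnd ℂ) (3 : ℂ) = 3 := Complex.conj_ofNat 3
    rw [h3] at hr'
    linear_combination (-(1 / 3) * Complex.exp (((-a : ℤ) * θ : ℝ) * Complex.I) *
      ((starRingEnd ℂ) (Fk κ θ)) ^ n * (Qk κ θ : ℂ)) * hr'
  · rw [Int.sign_eq_one_of_pos h]
    obtain ⟨n, rfl⟩ : ∃ n : ℕ, b = ((n + 1 : ℕ) : ℤ) := ⟨b.toNat - 1, by omega⟩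
    have e1 : ((n + 1 : ℕ) : ℤ) + 1 = ((n + 2 : ℕ) : ℤ) := by push_cast; ring
    have e2 : ((n + 1 : ℕ) : ℤ) - 1 = (n : ℤ) := by push_cast; ring
    unfold Ik
    rw [e1, e2, Ek_nat, Ek_nat, Ek_nat, exp_shift]
    linear_combination (-(1 / 3) * Complex.exp (((-a : ℤ) * θ : ℝ) * Complex.I) *
      (Fk κ θ) ^ n * (Qk κ θ : ℂ)) * hr

lemma Uk_rec {κ : ℝ} (hκ : 0 < κ) (a b : ℤ) (hb : b ≠ 0) :
    Uk κ a b = sk κ * ((Uk κ a (b + 1) + Uk κ a (b - 1) + Uk κ (a - Int.sign b) b) / 3) := by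
  have : ∫ θ in (-Real.pi)..Real.pi, Ik κ a b θ = sk κ / 3 *
      ((∫ θ in (-Real.pi)..Real.pi, Ik κ a (b + 1) θ) +
      (∫ θ in (-Real.pi)..Real.pi, Ik κ a (b - 1) θ) +
      (∫ θ in (-Real.pi)..Real.pi, Ik κ (a - Int.sign b) b θ)) := by
    rw [← intervalIntegral.integral_add (Ik_int hκ _ _ _ _) (Ik_int hκ _ _ _ _),
      ← intervalIntegral.integral_add ((Ik_int hκ _ _ _ _).add (Ik_int hκ _ _ _ _))
        (Ik_int hκ _ _ _ _), ← intervalIntegral.integral_const_mul]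
    apply intervalIntegral.integral_congr
    intro θ _
    exact (Ik_rec hκ a b hb θ).symm
  unfold Uk
  rw [this]; ring

lemma Ik_rec_zero {κ : ℝ} (hκ : 0 < κ) (a : ℤ) (θ : ℝ) :
    Ik κ a 0 θ = Complex.exp (((-a : ℤ) * θ : ℝ) * Complex.I) +
      sk κ / 2 * (Ik κ a 1 θ + Ik κ a (-1) θ) := by
  have e1 := Ek_nat κ 1 θ
  have e2 := Ek_neg κ 1 θ
  have e0 := Ek_nat κ 0 θ
  simp only [Nat.cast_one, Nat.cast_zero, pow_one, pow_zero] at e0 e1 e2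
  unfold Ik
  rw [e0, e1, e2]
  have hQ : (Qk κ θ : ℂ) * (1 - sk κ * (Fk κ θ).re) = 1 := by
    have : Qk κ θ * (1 - sk κ * (Fk κ θ).re) = 1 := by
      unfold Qk; rw [one_div, inv_mul_cancel₀ (Qden_ne hκ θ)]
    exact_mod_cast this
  have hre : Fk κ θ + (starRingEnd ℂ) (Fk κ θ) = 2 * ((Fk κ θ).re : ℂ) := by
    rw [Complex.add_conj]; push_cast; rfl
  linear_combination Complex.exp (((-a : ℤ) * θ : ℝ) * Complex.I) * hQ -
    sk κ / 2 * Complex.exp (((-a : ℤ) * θ : ℝ) * Complex.I) * (Qk κ θ : ℂ) * hre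

lemma int_exp (a : ℤ) : ∫ θ in (-Real.pi)..Real.pi, Complex.exp (((-a : ℤ) * θ : ℝ) * Complex.I) =
    if a = 0 then ((2 * Real.pi : ℝ) : ℂ) else 0 := by
  split_ifs with h
  · subst h; simp; ring
  · have hc : (((-a : ℤ) : ℂ) * Complex.I) ≠ 0 := by
      apply mul_ne_zero _ Complex.I_ne_zero
      exact_mod_cast neg_ne_zero.2 h
    have e : ∀ θ : ℝ, Complex.exp (((-a : ℤ) * θ : ℝ) * Complex.I) =
        Complex.exp ((((-a : ℤ) : ℂ) * Complex.I) * θ) := by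
      intro θ; congr 1; push_cast; ring
    simp_rw [e]
    rw [integral_exp_mul_complex hc]
    have : Complex.exp ((((-a : ℤ) : ℂ) * Complex.I) * (Real.pi : ℝ)) =
        Complex.exp ((((-a : ℤ) : ℂ) * Complex.I) * ((-Real.pi : ℝ) : ℝ)) := by
      rw [Complex.exp_eq_exp_iff_exists_int]
      exact ⟨-a, by push_cast; ring⟩
    rw [this, sub_self, zero_div]

lemma Uk_rec_zero {κ : ℝ} (hκ : 0 < κ) (a : ℤ) :
    Uk κ a 0 = (if a = 0 then 1 else 0) + sk κ * ((Uk κ a 1 + Uk κ a (-1)) / 2) := by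
  have hexp : IntervalIntegrable (fun θ : ℝ => Complex.exp (((-a : ℤ) * θ : ℝ) * Complex.I))
      volume (-Real.pi) Real.pi := by
    apply Continuous.intervalIntegrable; fun_prop
  have : ∫ θ in (-Real.pi)..Real.pi, Ik κ a 0 θ =
      (if a = 0 then ((2 * Real.pi : ℝ) : ℂ) else 0) + sk κ / 2 *
      ((∫ θ in (-Real.pi)..Real.pi, Ik κ a 1 θ) +
      (∫ θ in (-Real.pi)..Real.pi, Ik κ a (-1) θ)) := by
    rw [← int_exp, ← intervalIntegral.integral_add (Ik_int hκ _ _ _ _) (Ik_int hκ _ _ _ _),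
      ← intervalIntegral.integral_const_mul, ← intervalIntegral.integral_add hexp
      (((Ik_int hκ _ _ _ _).add (Ik_int hκ _ _ _ _)).const_mul _)]
    apply intervalIntegral.integral_congr
    intro θ _
    exact Ik_rec_zero hκ a θ
  unfold Uk
  rw [this]
  have hpi : ((2 * Real.pi : ℝ) : ℂ) ≠ 0 := by
    have : (2 * Real.pi : ℝ) ≠ 0 := by positivity
    exact_mod_cast this
  split_ifs
  · rw [mul_add, Complex.ofReal_inv, inv_mul_cancel₀ hpi]; ring
  · ring

lemma Uk_bdd {κ : ℝ} (hκ : 0 < κ) (a b : ℤ) : ‖Uk κ a b‖ ≤ 1 / (1 - sk κ) := by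
  unfold Uk
  have := intervalIntegral.norm_integral_le_of_norm_le_const (a := -Real.pi) (b := Real.pi)
    (f := Ik κ a b) (C := 1 / (1 - sk κ)) (fun θ _ => (Ik_norm hκ a b θ).trans (Qk_le' hκ θ))
  have hpi := Real.pi_pos
  rw [norm_mul, Complex.norm_real, Real.norm_of_nonneg (by positivity)]
  rw [show |Real.pi - -Real.pi| = 2 * Real.pi by rw [abs_of_pos] <;> linarith] at this
  calc _ ≤ (2 * Real.pi)⁻¹ * (1 / (1 - sk κ) * (2 * Real.pi)) := by gcongr
    _ = _ := by field_simp

lemma Uk_eq {κ : ℝ} (hκ : 0 < κ) (a b : ℤ) : Uk κ a b = (Vs (sk κ) a b : ℂ) := by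
  have s0 := sk_pos hκ
  have s1 := sk_lt hκ
  set C := 1 / (1 - sk κ) + (1 - sk κ)⁻¹ with hC
  have key : ∀ n : ℕ, ∀ a b : ℤ, ‖Uk κ a b - (Vs (sk κ) a b : ℂ)‖ ≤ (sk κ) ^ n * C := by
    intro n
    induction n with
    | zero =>
      intro a b
      refine (norm_sub_le _ _).trans ?_
      rw [pow_zero, one_mul, hC, Complex.norm_real, Real.norm_of_nonneg (Vs_nonneg s0.le a b)]
      exact add_le_add (Uk_bdd hκ a b) (Vs_bdd s0.le s1 a b)
    | succ n ih =>
      intro a b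
      by_cases hb : b = 0
      · subst hb
        rw [Uk_rec_zero hκ, Vs_rec_zero s0.le s1]
        have e : (if a = 0 then (1 : ℂ) else 0) + sk κ * ((Uk κ a 1 + Uk κ a (-1)) / 2) -
          (((if a = 0 then (1 : ℝ) else 0) + sk κ * ((Vs (sk κ) a 1 + Vs (sk κ) a (-1)) / 2) : ℝ) : ℂ)
          = ((sk κ / 2 : ℝ) : ℂ) * ((Uk κ a 1 - (Vs (sk κ) a 1 : ℂ)) +
            (Uk κ a (-1) - (Vs (sk κ) a (-1) : ℂ))) := by
          split_ifs <;> push_cast <;> ring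
        rw [e, norm_mul, Complex.norm_real, Real.norm_of_nonneg (by positivity)]
        have h1 := ih a 1
        have h2 := ih a (-1)
        have h3 := (norm_add_le (Uk κ a 1 - (Vs (sk κ) a 1 : ℂ)) (Uk κ a (-1) - (Vs (sk κ) a (-1) : ℂ)))
        calc _ ≤ sk κ / 2 * (sk κ ^ n * C + sk κ ^ n * C) := by gcongr; linarith
          _ = _ := by ring
      · rw [Uk_rec hκ a b hb, Vs_rec s0.le s1 a b hb]
        have e : sk κ * ((Uk κ a (b + 1) + Uk κ a (b - 1) + Uk κ (a - Int.sign b) b) / 3) -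
          ((sk κ * ((Vs (sk κ) a (b + 1) + Vs (sk κ) a (b - 1) + Vs (sk κ) (a - Int.sign b) b) / 3) : ℝ) : ℂ)
          = ((sk κ / 3 : ℝ) : ℂ) * ((Uk κ a (b + 1) - (Vs (sk κ) a (b + 1) : ℂ)) +
            (Uk κ a (b - 1) - (Vs (sk κ) a (b - 1) : ℂ)) +
            (Uk κ (a - Int.sign b) b - (Vs (sk κ) (a - Int.sign b) b : ℂ))) := by
          push_cast; ring
        rw [e, norm_mul, Complex.norm_real, Real.norm_of_nonneg (by positivity)]
        have h1 := ih a (b + 1)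
        have h2 := ih a (b - 1)
        have h3 := ih (a - Int.sign b) b
        have h4 := norm_add₃_le (a := Uk κ a (b + 1) - (Vs (sk κ) a (b + 1) : ℂ))
          (b := Uk κ a (b - 1) - (Vs (sk κ) a (b - 1) : ℂ))
          (c := Uk κ (a - Int.sign b) b - (Vs (sk κ) (a - Int.sign b) b : ℂ))
        calc _ ≤ sk κ / 3 * (sk κ ^ n * C + sk κ ^ n * C + sk κ ^ n * C) := by gcongr; linarith
          _ = _ := by ring
  have hlim : Tendsto (fun n : ℕ => (sk κ) ^ n * C) atTop (nhds 0) := by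
    simpa using (tendsto_pow_atTop_nhds_zero_of_lt_one s0.le s1).mul_const C
  have := ge_of_tendsto' hlim (fun n => key n a b)
  exact sub_eq_zero.1 (norm_le_zero_iff.1 this)

open MeasureTheory

lemma two_pi_inv_le : (2 * Real.pi)⁻¹ ≤ (1 : ℝ) := by
  apply inv_le_one_of_one_le₀
  linarith [Real.pi_gt_three]

lemma norm_two_pi_inv_mul_le (z : ℂ) : ‖(((2 * Real.pi : ℝ)⁻¹ : ℝ) : ℂ) * z‖ ≤ ‖z‖ := by
  rw [norm_mul, Complex.norm_real, Real.norm_of_nonneg (by positivity)]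
  exact mul_le_of_le_one_left (norm_nonneg _) two_pi_inv_le

lemma Vs_unif {κ : ℝ} (hκ : 0 < κ) (h1 : κ ≤ 1) (a b : ℤ) : Vs (sk κ) a b ≤ 4 / 3 * 5 * J0 := by
  have h := Uk_eq hκ a b
  have e : Vs (sk κ) a b = ‖Uk κ a b‖ := by
    rw [h, Complex.norm_real, Real.norm_of_nonneg (Vs_nonneg (sk_pos hκ).le a b)]
  rw [e]
  unfold Uk
  refine (norm_two_pi_inv_mul_le _).trans ?_
  exact norm_int_le hκ h1 (by norm_num) (fun θ => (Ik_norm hκ a b θ).trans (Qk_le hκ h1 θ))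

/-- the difference symbol -/
def Hk (κ : ℝ) (n : ℕ) (θ : ℝ) : ℂ :=
  (1 - Complex.exp (θ * Complex.I)) * (Fk κ θ) ^ n * (Qk κ θ : ℂ)

lemma Vs_diff {κ : ℝ} (hκ : 0 < κ) (a : ℤ) (n : ℕ) :
    ((Vs (sk κ) a n - Vs (sk κ) (a - 1) n : ℝ) : ℂ) =
    (((2 * Real.pi : ℝ)⁻¹ : ℝ) : ℂ) *
      ∫ θ in (-Real.pi)..Real.pi, Complex.exp (((-a : ℤ) * θ : ℝ) * Complex.I) * Hk κ n θ := by
  rw [Complex.ofReal_sub, ← Uk_eq hκ, ← Uk_eq hκ]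
  unfold Uk
  rw [← mul_sub, ← intervalIntegral.integral_sub (Ik_int hκ _ _ _ _) (Ik_int hκ _ _ _ _)]
  push_cast
  congr 1
  apply intervalIntegral.integral_congr
  intro θ _
  simp only [Ik, Ek_nat, exp_shift, Hk]
  push_cast
  ring

lemma pow_bound1 {x f : ℝ} (hx : 0 < x) (hf0 : 0 ≤ f) (hf : f * (1 + x) ≤ 1) (n : ℕ) :
    n * f ^ n ≤ 1 / x := by
  have h1 : 1 + n * x ≤ (1 + x) ^ n := one_add_mul_le_pow (by linarith) n
  have h2 : f ^ n * (1 + x) ^ n ≤ 1 := by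
    rw [← mul_pow]; exact pow_le_one₀ (by positivity) hf
  rw [le_div_iff₀ hx]
  have h3 := pow_nonneg hf0 n
  nlinarith

lemma pow_lower2 {x : ℝ} (hx : 0 < x) (n : ℕ) :
    1 + n * x + n * (n - 1) / 2 * x ^ 2 ≤ (1 + x) ^ n := by
  induction n with
  | zero => simp
  | succ n ih =>
    rw [pow_succ (1 + x) n]
    push_cast
    have : (0 : ℝ) ≤ n * (n - 1) := by
      rcases n with _ | n
      · simp
      · push_cast; nlinarith [(Nat.cast_nonneg n : (0 : ℝ) ≤ n)]
    have h3 : 0 ≤ (n : ℝ) * (n - 1) * x ^ 3 := by positivity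
    have h4 := mul_le_mul_of_nonneg_right ih (show 0 ≤ 1 + x by linarith)
    refine le_trans ?_ h4
    linarith [h3]

lemma pow_bound2 {x f : ℝ} (hx : 0 < x) (hx1 : x ≤ 1) (hf0 : 0 ≤ f) (hf : f * (1 + x) ≤ 1) (n : ℕ) :
    (n : ℝ) ^ 2 * x ^ 2 * f ^ n ≤ 4 := by
  have h1 := pow_lower2 hx n
  have h2 : f ^ n * (1 + x) ^ n ≤ 1 := by
    rw [← mul_pow]; exact pow_le_one₀ (by positivity) hf
  have h3 := pow_nonneg hf0 n
  have hn : (0 : ℝ) ≤ n := Nat.cast_nonneg n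
  have h4 : (n : ℝ) ^ 2 * x ^ 2 ≤ 4 * (1 + x) ^ n := by
    have : (n : ℝ) * x ^ 2 ≤ n * x := by
      apply mul_le_mul_of_nonneg_left _ hn; nlinarith
    nlinarith [sq_nonneg ((n : ℝ) * x)]
  nlinarith

lemma Hk_bound {κ : ℝ} (hκ : 0 < κ) (h1 : κ ≤ 1) (n : ℕ) (θ : ℝ) :
    (n : ℝ) ^ 2 * ‖Hk κ n θ‖ ≤ 64 * (1 / (1 - (Fk κ θ).re)) := by
  obtain ⟨hx, hx1, hf, hw, -⟩ := Fk_bounds hκ h1 θ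
  have hQ := Qk_le hκ h1 θ
  have hQ0 := (Qk_pos hκ θ).le
  unfold Hk
  rw [norm_mul, norm_mul, Complex.norm_real, Real.norm_of_nonneg hQ0, norm_pow]
  set x := 1 - (Fk κ θ).re
  have h2 := pow_bound2 hx hx1 (norm_nonneg (Fk κ θ)) hf n
  calc (n : ℝ) ^ 2 * (‖1 - Complex.exp (θ * Complex.I)‖ * ‖Fk κ θ‖ ^ n * Qk κ θ)
      ≤ (n : ℝ) ^ 2 * (12 * x ^ 2 * ‖Fk κ θ‖ ^ n * (4 / 3 * (1 / x))) := by gcongr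
    _ = 16 * ((n : ℝ) ^ 2 * x ^ 2 * ‖Fk κ θ‖ ^ n) * (1 / x) := by ring
    _ ≤ 16 * 4 * (1 / x) := by gcongr
    _ = _ := by ring

lemma D_bound_b {κ : ℝ} (hκ : 0 < κ) (h1 : κ ≤ 1) (a : ℤ) (n : ℕ) :
    (n : ℝ) ^ 2 * |Vs (sk κ) a n - Vs (sk κ) (a - 1) n| ≤ 64 * 5 * J0 := by
  have h := congrArg norm (Vs_diff hκ a n)
  rw [Complex.norm_real, Real.norm_eq_abs] at h
  rw [h]
  have e : (n : ℝ) ^ 2 = ‖((n : ℂ) ^ 2)‖ := by simp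
  calc _ ≤ (n : ℝ) ^ 2 * ‖∫ θ in (-Real.pi)..Real.pi, Complex.exp (((-a : ℤ) * θ : ℝ) * Complex.I) * Hk κ n θ‖ := by
        gcongr; exact norm_two_pi_inv_mul_le _
    _ = ‖∫ θ in (-Real.pi)..Real.pi, ((n : ℂ) ^ 2) * (Complex.exp (((-a : ℤ) * θ : ℝ) * Complex.I) * Hk κ n θ)‖ := by
        rw [intervalIntegral.integral_const_mul, norm_mul, ← e]
    _ ≤ _ := by
        apply norm_int_le hκ h1 (by norm_num)
        intro θ
        rw [norm_mul, norm_mul, Complex.norm_exp_ofReal_mul_I, ← e, one_mul]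
        exact Hk_bound hκ h1 n θ

/-- derivative of the difference symbol -/
def Hk' (κ : ℝ) (n : ℕ) (θ : ℝ) : ℂ :=
  -(Complex.exp (θ * Complex.I) * Complex.I) * (Fk κ θ) ^ n * (Qk κ θ : ℂ) +
  (1 - Complex.exp (θ * Complex.I)) * (n * (Fk κ θ) ^ (n - 1) * Fk' κ θ) * (Qk κ θ : ℂ) +
  (1 - Complex.exp (θ * Complex.I)) * (Fk κ θ) ^ n *
    ((sk κ * (Fk' κ θ).re * (Qk κ θ) ^ 2 : ℝ) : ℂ)

lemma Qk_hasDerivAt {κ : ℝ} (hκ : 0 < κ) (θ : ℝ) :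
    HasDerivAt (Qk κ) (sk κ * (Fk' κ θ).re * (Qk κ θ) ^ 2) θ := by
  have hre : HasDerivAt (fun t => (Fk κ t).re) (Fk' κ θ).re θ :=
    (Complex.reCLM.hasFDerivAt.comp_hasDerivAt θ (Fk_hasDerivAt hκ θ))
  have := ((hre.const_mul (sk κ)).const_sub 1).inv (Qden_ne hκ θ)
  have e : Qk κ = (fun t => 1 - sk κ * (Fk κ t).re)⁻¹ := by
    funext t; simp [Qk]
  rw [← e] at this
  refine this.congr_deriv ?_
  have e2 : Qk κ θ = (1 - sk κ * (Fk κ θ).re)⁻¹ := by simp [Qk]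
  rw [e2]
  have := Qden_ne hκ θ
  field_simp

lemma exp_hasDerivAt (θ : ℝ) : HasDerivAt (fun φ : ℝ => Complex.exp (φ * Complex.I))
      (Complex.exp (θ * Complex.I) * Complex.I) θ := by
  have := ((Complex.ofRealCLM.hasDerivAt (x := θ)).mul_const Complex.I).cexp
  simpa using this

lemma Hk_hasDerivAt {κ : ℝ} (hκ : 0 < κ) (n : ℕ) (θ : ℝ) :
    HasDerivAt (Hk κ n) (Hk' κ n θ) θ := by
  have h1 := (exp_hasDerivAt θ).const_sub 1
  have h2 := (Fk_hasDerivAt hκ θ).pow n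
  have h3 := (Qk_hasDerivAt hκ θ).ofReal_comp
  have := (h1.mul h2).mul h3
  refine HasDerivAt.congr_deriv (f := Hk κ n) this ?_
  unfold Hk'
  simp only [Pi.mul_apply, Pi.pow_apply]
  ring

lemma Hk'_continuous {κ : ℝ} (hκ : 0 < κ) (n : ℕ) : Continuous (Hk' κ n) := by
  have h1 := Fk_continuous hκ
  have h2 := Fk'_continuous hκ
  have h3 := Qk_continuous hκ
  have h4 : Continuous fun θ => (Fk' κ θ).re := Complex.continuous_re.comp h2
  unfold Hk'
  generalize Fk' κ = g at *
  fun_prop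

lemma Hk_continuous {κ : ℝ} (hκ : 0 < κ) (n : ℕ) : Continuous (Hk κ n) := by
  have h1 := Fk_continuous hκ
  have h3 := Qk_continuous hκ
  unfold Hk
  fun_prop

lemma Hk_periodic {κ : ℝ} (n : ℕ) : Hk κ n (-Real.pi) = Hk κ n Real.pi := by
  have : Complex.exp ((-Real.pi : ℝ) * Complex.I) = Complex.exp ((Real.pi : ℝ) * Complex.I) := by
    rw [Complex.ofReal_neg, neg_mul, Complex.exp_neg, Complex.exp_pi_mul_I]; norm_num
  unfold Hk Qk
  rw [Fk_periodic, this]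

lemma exp_periodic (a : ℤ) : Complex.exp (((-a : ℤ) * (-Real.pi) : ℝ) * Complex.I) =
    Complex.exp (((-a : ℤ) * Real.pi : ℝ) * Complex.I) := by
  rw [Complex.exp_eq_exp_iff_exists_int]
  exact ⟨a, by push_cast; ring⟩

lemma Hk'_bound {κ : ℝ} (hκ : 0 < κ) (h1 : κ ≤ 1) (n : ℕ) (θ : ℝ) :
    ‖Hk' κ n θ‖ ≤ 40 * (1 / (1 - (Fk κ θ).re)) := by
  obtain ⟨hx, hx1, hf, hw, -⟩ := Fk_bounds hκ h1 θ
  have hQ := Qk_le hκ h1 θ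
  have hQ0 := (Qk_pos hκ θ).le
  have hF' := Fk'_bound hκ h1 θ
  have hs := (sk_lt hκ).le
  have hs0 := (sk_pos hκ).le
  have hFn := (Fk_norm hκ θ).le
  unfold Hk'
  set x := 1 - (Fk κ θ).re
  have hF0 := norm_nonneg (Fk κ θ)
  have hF'' : ‖Fk' κ θ‖ ≤ ‖Fk κ θ‖ * (1 / x) := by
    rw [mul_one_div, le_div_iff₀ hx]; exact hF'
  have h2 := pow_bound1 hx hF0 hf n
  have hpn : ‖Fk κ θ‖ ^ n ≤ 1 := pow_le_one₀ hF0 hFn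
  have t1 : ‖-(Complex.exp (θ * Complex.I) * Complex.I) * (Fk κ θ) ^ n * (Qk κ θ : ℂ)‖
      ≤ 4 / 3 * (1 / x) := by
    rw [norm_mul, norm_mul, norm_neg, norm_mul, Complex.norm_exp_ofReal_mul_I, Complex.norm_I,
      Complex.norm_real, Real.norm_of_nonneg hQ0, norm_pow]
    calc _ ≤ 1 * 1 * 1 * (4 / 3 * (1 / x)) := by gcongr
      _ = _ := by ring
  have t2 : ‖(1 - Complex.exp (θ * Complex.I)) * (n * (Fk κ θ) ^ (n - 1) * Fk' κ θ) * (Qk κ θ : ℂ)‖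
      ≤ 16 * (1 / x) := by
    rw [norm_mul, norm_mul, norm_mul, norm_mul, norm_pow,
      Complex.norm_real, Real.norm_of_nonneg hQ0, Complex.norm_natCast]
    calc _ ≤ 12 * x ^ 2 * (n * ‖Fk κ θ‖ ^ (n - 1) * (‖Fk κ θ‖ * (1 / x))) * (4 / 3 * (1 / x)) := by
          gcongr
      _ = 16 * (n * (‖Fk κ θ‖ ^ (n - 1) * ‖Fk κ θ‖)) * (x * (1 / x)) ^ 2 := by ring
      _ = 16 * (n * ‖Fk κ θ‖ ^ n) := by
          rw [mul_one_div_cancel hx.ne', one_pow, mul_one]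
          rcases n with _ | n
          · simp
          · rw [Nat.add_sub_cancel, ← pow_succ]
      _ ≤ _ := by gcongr
  have t3 : ‖(1 - Complex.exp (θ * Complex.I)) * (Fk κ θ) ^ n *
    ((sk κ * (Fk' κ θ).re * (Qk κ θ) ^ 2 : ℝ) : ℂ)‖ ≤ 64 / 3 * (1 / x) := by
    have hr : |(Fk' κ θ).re| ≤ 1 * (1 / x) := by
      refine (Complex.abs_re_le_norm _).trans (hF''.trans ?_)
      gcongr
    rw [norm_mul, norm_mul, norm_pow, Complex.norm_real, Real.norm_eq_abs, abs_mul, abs_mul,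
      abs_of_nonneg hs0, abs_of_nonneg (by positivity : (0:ℝ) ≤ Qk κ θ ^ 2)]
    calc _ ≤ 12 * x ^ 2 * 1 * (1 * (1 * (1 / x)) * (4 / 3 * (1 / x)) ^ 2) := by gcongr
      _ = 64 / 3 * (1 / x) * (x * (1 / x)) ^ 2 := by ring
      _ = _ := by rw [mul_one_div_cancel hx.ne']; ring
  refine (norm_add₃_le).trans ?_
  have : 0 < 1 / x := by positivity
  linarith

lemma D_bound_a {κ : ℝ} (hκ : 0 < κ) (h1 : κ ≤ 1) (a : ℤ) (n : ℕ) :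
    |(a : ℝ)| * |Vs (sk κ) a n - Vs (sk κ) (a - 1) n| ≤ 40 * 5 * J0 := by
  have h := congrArg norm (Vs_diff hκ a n)
  rw [Complex.norm_real, Real.norm_eq_abs] at h
  rw [h]
  set ex : ℝ → ℂ := fun θ => Complex.exp (((-a : ℤ) * θ : ℝ) * Complex.I) with hex
  have hexd : ∀ θ : ℝ, HasDerivAt ex (ex θ * (-a * Complex.I)) θ := by
    intro θ
    have h2 : HasDerivAt (fun φ : ℝ => ((((-a : ℤ) * φ : ℝ)) : ℂ) * Complex.I) (-a * Complex.I) θ := by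
      have := (((hasDerivAt_id θ).const_mul (((-a : ℤ) : ℝ))).ofReal_comp).mul_const Complex.I
      simpa using this
    exact h2.cexp
  have hexc : Continuous ex := by rw [hex]; fun_prop
  have hparts : ∫ θ in (-Real.pi)..Real.pi, (ex θ * (-a * Complex.I) * Hk κ n θ + ex θ * Hk' κ n θ) = 0 := by
    have hc := Hk_continuous hκ n
    have hc' := Hk'_continuous hκ n
    rw [intervalIntegral.integral_eq_sub_of_hasDerivAt (f := fun θ => ex θ * Hk κ n θ)
      (fun θ _ => (hexd θ).mul (Hk_hasDerivAt hκ n θ))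
      ((Continuous.intervalIntegrable (by fun_prop) _ _))]
    simp only [hex]
    rw [Hk_periodic, exp_periodic, sub_self]
  have hparts2 : (a * Complex.I) * ∫ θ in (-Real.pi)..Real.pi, ex θ * Hk κ n θ =
      ∫ θ in (-Real.pi)..Real.pi, ex θ * Hk' κ n θ := by
    have hc := Hk_continuous hκ n
    have hc' := Hk'_continuous hκ n
    rw [intervalIntegral.integral_add (Continuous.intervalIntegrable (by fun_prop) _ _)
      (Continuous.intervalIntegrable (by fun_prop) _ _)] at hparts
    have e : ∫ θ in (-Real.pi)..Real.pi, ex θ * (-a * Complex.I) * Hk κ n θ =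
        (-a * Complex.I) * ∫ θ in (-Real.pi)..Real.pi, ex θ * Hk κ n θ := by
      rw [← intervalIntegral.integral_const_mul]
      apply intervalIntegral.integral_congr
      intro θ _
      simp only
      ring
    rw [e] at hparts
    linear_combination -hparts
  have e : |(a : ℝ)| = ‖(a * Complex.I : ℂ)‖ := by simp
  calc _ ≤ |(a : ℝ)| * ‖∫ θ in (-Real.pi)..Real.pi, ex θ * Hk κ n θ‖ := by
        gcongr; exact norm_two_pi_inv_mul_le _
    _ = ‖∫ θ in (-Real.pi)..Real.pi, ex θ * Hk' κ n θ‖ := by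
        rw [← hparts2, norm_mul, e]
    _ ≤ _ := by
        apply norm_int_le hκ h1 (by norm_num)
        intro θ
        rw [norm_mul, hex]
        simp only [Complex.norm_exp_ofReal_mul_I, one_mul]
        exact Hk'_bound hκ h1 n θ

open MeasureTheory

/-- a sequence of parameters tending to zero -/
def kap (n : ℕ) : ℝ := 1 / ((n : ℝ) + 1)

lemma kap_pos (n : ℕ) : 0 < kap n := by unfold kap; positivity
lemma kap_le (n : ℕ) : kap n ≤ 1 := by
  unfold kap; rw [div_le_one (by positivity)]; linarith [(Nat.cast_nonneg n : (0 : ℝ) ≤ n)]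
lemma sk_kap_tendsto : Tendsto (fun n => sk (kap n)) atTop (nhds 1) := by
  have h1 : Tendsto kap atTop (nhds 0) := tendsto_one_div_add_atTop_nhds_zero_nat
  have : Tendsto (fun n => 3 / (3 + kap n)) atTop (nhds (3 / (3 + 0))) := by
    apply Tendsto.div tendsto_const_nhds (h1.const_add 3); norm_num
  simpa [sk] using this

lemma qn_summable (a b : ℤ) : Summable (fun n => qn n a b) := by
  apply summable_of_sum_range_le (c := 4 / 3 * 5 * J0) (fun n => qn_nonneg n a b)
  intro N
  have h1 : Tendsto (fun k => ∑ n ∈ Finset.range N, sk (kap k) ^ n * qn n a b) atTop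
      (nhds (∑ n ∈ Finset.range N, (1 : ℝ) ^ n * qn n a b)) := by
    apply tendsto_finsetSum
    intro n _
    exact (sk_kap_tendsto.pow n).mul_const _
  simp only [one_pow, one_mul] at h1
  apply le_of_tendsto' h1
  intro k
  refine le_trans ?_ (Vs_unif (kap_pos k) (kap_le k) a b)
  apply (Vs_summable (sk_pos (kap_pos k)).le (sk_lt (kap_pos k)) a b).sum_le_tsum
  intro n _
  exact mul_nonneg (pow_nonneg (sk_pos (kap_pos k)).le _) (qn_nonneg n a b)

/-- normalised Green function -/
def uu (a b : ℤ) : ℝ := ∑' n, qn n a b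

lemma uu_nonneg (a b : ℤ) : 0 ≤ uu a b := tsum_nonneg (fun n => qn_nonneg n a b)

lemma uu_symm (a b : ℤ) : uu (-a) (-b) = uu a b := by
  unfold uu; simp only [qn_symm]

lemma greenFn_eq (z a b : ℤ) : greenFn (z, 0) (a, b) = wt b * uu (a - z) b := by
  unfold greenFn uu
  simp only [kernelPow_eq, tsum_mul_left]

lemma Vs_le_uu {κ : ℝ} (hκ : 0 < κ) (a b : ℤ) : Vs (sk κ) a b ≤ uu a b := by
  apply (Vs_summable (sk_pos hκ).le (sk_lt hκ) a b).tsum_le_tsum _ (qn_summable a b)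
  intro n
  exact mul_le_of_le_one_left (qn_nonneg n a b) (pow_le_one₀ (sk_pos hκ).le (sk_lt hκ).le)

lemma Vs_tendsto (a b : ℤ) : Tendsto (fun k => Vs (sk (kap k)) a b) atTop (nhds (uu a b)) := by
  unfold Vs uu
  apply tendsto_tsum_of_dominated_convergence (qn_summable a b)
  · intro n
    have := (sk_kap_tendsto.pow n).mul_const (qn n a b)
    simpa using this
  · refine Eventually.of_forall (fun k n => ?_)
    have h := sk_pos (kap_pos k)
    rw [Real.norm_of_nonneg (mul_nonneg (pow_nonneg h.le _) (qn_nonneg n a b))]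
    exact mul_le_of_le_one_left (qn_nonneg n a b) (pow_le_one₀ h.le (sk_lt (kap_pos k)).le)

lemma uu_bdd (a b : ℤ) : uu a b ≤ 4 / 3 * 5 * J0 :=
  le_of_tendsto' (Vs_tendsto a b) (fun k => Vs_unif (kap_pos k) (kap_le k) a b)

lemma uu_diff_b (a : ℤ) (n : ℕ) : (n : ℝ) ^ 2 * |uu a n - uu (a - 1) n| ≤ 64 * 5 * J0 :=
  le_of_tendsto' (((Vs_tendsto a n).sub (Vs_tendsto (a - 1) n)).abs.const_mul _)
    (fun k => D_bound_b (kap_pos k) (kap_le k) a n)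

lemma uu_diff_a (a : ℤ) (n : ℕ) : |(a : ℝ)| * |uu a n - uu (a - 1) n| ≤ 40 * 5 * J0 :=
  le_of_tendsto' (((Vs_tendsto a n).sub (Vs_tendsto (a - 1) n)).abs.const_mul _)
    (fun k => D_bound_a (kap_pos k) (kap_le k) a n)

lemma uu_rec (a b : ℤ) (hb : b ≠ 0) :
    3 * uu a b = uu a (b + 1) + uu a (b - 1) + uu (a - Int.sign b) b := by
  have h : uu a b = (uu a (b + 1) + uu a (b - 1) + uu (a - Int.sign b) b) / 3 := by
    unfold uu
    rw [(qn_summable a b).tsum_eq_zero_add, ← (qn_summable a (b+1)).tsum_add (qn_summable a (b-1)),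
      ← ((qn_summable a (b+1)).add (qn_summable a (b-1))).tsum_add (qn_summable _ b), ← tsum_div_const]
    simp [qn, hb]
  linarith

lemma uu_rec_zero (a : ℤ) :
    uu a 0 = (if a = 0 then 1 else 0) + (uu a 1 + uu a (-1)) / 2 := by
  unfold uu
  rw [(qn_summable a 0).tsum_eq_zero_add, ← (qn_summable a 1).tsum_add (qn_summable a (-1)),
    ← tsum_div_const]
  simp [qn]

lemma uu_rec_pos (a : ℤ) (b : ℕ) :
    3 * uu a ((b + 1 : ℕ) : ℤ) = uu a ((b + 2 : ℕ) : ℤ) + uu a (b : ℤ) + uu (a - 1) ((b + 1 : ℕ) : ℤ) := by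
  have h := uu_rec a ((b + 1 : ℕ) : ℤ) (by omega)
  rw [Int.sign_natCast_of_ne_zero (by omega)] at h
  rw [h]
  have e1 : ((b + 1 : ℕ) : ℤ) + 1 = ((b + 2 : ℕ) : ℤ) := by push_cast; ring
  have e2 : ((b + 1 : ℕ) : ℤ) - 1 = (b : ℤ) := by push_cast; ring
  rw [e1, e2]

lemma uu_zero_pos : 1 ≤ uu 0 0 := by
  rw [uu_rec_zero]
  have := uu_nonneg 0 1
  have := uu_nonneg 0 (-1)
  simp; linarith

lemma uu_axis (a : ℤ) : (uu a 1 + uu (-a) 1) / 2 ≤ uu a 0 := by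
  rw [uu_rec_zero, ← uu_symm (-a) 1, neg_neg]
  split_ifs <;> linarith

/-- The scale. -/
def MM (a b : ℤ) : ℝ := |(a : ℝ)| + (b : ℝ) ^ 2 + 1

lemma MM_pos (a b : ℤ) : 1 ≤ MM a b := by
  unfold MM; have := abs_nonneg (a : ℝ); nlinarith [sq_nonneg (b : ℝ)]

/-- The constant in the difference bound. -/
def CD : ℝ := 1000 * J0 + 1

lemma CD_pos : 0 < CD := by unfold CD; linarith [J0_nonneg]

lemma uu_diff_nat (a : ℤ) (n : ℕ) : (|(a : ℝ)| + (n : ℝ) ^ 2 + 2) * |uu a n - uu (a - 1) n| ≤ CD := by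
  have h1 := uu_diff_a a n
  have h2 := uu_diff_b a n
  have h3 : |uu a n - uu (a - 1) n| ≤ 4 / 3 * 5 * J0 := by
    rw [abs_le]
    constructor <;> linarith [uu_bdd a n, uu_bdd (a-1) n, uu_nonneg a n, uu_nonneg (a-1) n]
  have := J0_nonneg
  unfold CD
  nlinarith

lemma uu_diff (a b : ℤ) : MM a b * |uu a b - uu (a - 1) b| ≤ CD := by
  rcases le_total 0 b with hb | hb
  · obtain ⟨n, rfl⟩ := Int.eq_ofNat_of_zero_le hb
    have h := uu_diff_nat a n
    unfold MM
    push_cast at h ⊢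
    have := abs_nonneg (uu a n - uu (a - 1) n)
    linarith
  · obtain ⟨n, hn⟩ := Int.eq_ofNat_of_zero_le (neg_nonneg.mpr hb)
    have hb' : b = -(n : ℤ) := by omega
    subst hb'
    have h := uu_diff_nat (1 - a) n
    have e1 : uu a (-(n : ℤ)) = uu (-a) n := by rw [← uu_symm, neg_neg]
    have e2 : uu (a - 1) (-(n : ℤ)) = uu (1 - a) n := by
      rw [← uu_symm, neg_neg, neg_sub]
    rw [e1, e2, abs_sub_comm]
    rw [show 1 - a - 1 = -a by ring] at h
    refine le_trans (mul_le_mul_of_nonneg_right ?_ (abs_nonneg _)) h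
    unfold MM
    push_cast
    have : |(a : ℝ)| ≤ |1 - (a : ℝ)| + 1 := by
      have := abs_sub_abs_le_abs_sub (a : ℝ) 1
      rw [abs_one, abs_sub_comm] at this; linarith
    nlinarith

open MeasureTheory

lemma Vs_cos {κ : ℝ} (hκ : 0 < κ) (a : ℤ) :
    Vs (sk κ) a 0 = (2 * Real.pi)⁻¹ * ∫ θ in (-Real.pi)..Real.pi, Real.cos (a * θ) * Qk κ θ := by
  have h := congrArg Complex.re (Uk_eq hκ a 0)
  rw [Complex.ofReal_re] at h
  rw [← h]
  unfold Uk
  rw [Complex.re_ofReal_mul]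
  congr 1
  have := Complex.reCLM.intervalIntegral_comp_comm (Ik_int hκ a 0 (-Real.pi) Real.pi)
  rw [Complex.reCLM_apply] at this
  rw [← this]
  apply intervalIntegral.integral_congr
  intro θ _
  have e := Ek_nat κ 0 θ
  simp only [Nat.cast_zero, pow_zero] at e
  simp only [Ik, Complex.reCLM_apply, e, mul_one]
  rw [Complex.re_mul_ofReal, Complex.exp_ofReal_mul_I_re]
  push_cast
  rw [neg_mul, Real.cos_neg]

lemma cos_sum_eq (N : ℕ) (θ : ℝ) :
    ∑ i ∈ Finset.range N, ∑ j ∈ Finset.range N, Real.cos ((((i : ℤ) - (j : ℤ) : ℤ) : ℝ) * θ) =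
    (∑ i ∈ Finset.range N, Real.cos (i * θ)) ^ 2 + (∑ i ∈ Finset.range N, Real.sin (i * θ)) ^ 2 := by
  rw [sq, sq, Finset.sum_mul_sum, Finset.sum_mul_sum, ← Finset.sum_add_distrib]
  apply Finset.sum_congr rfl; intro i _
  rw [← Finset.sum_add_distrib]
  apply Finset.sum_congr rfl; intro j _
  push_cast
  rw [sub_mul, Real.cos_sub]

lemma cos_sum_ge (N : ℕ) (hN : 1 ≤ N) {θ : ℝ} (hθ : |θ| ≤ 1 / N) : (N : ℝ) ^ 2 / 2 ≤
    ∑ i ∈ Finset.range N, ∑ j ∈ Finset.range N, Real.cos ((((i : ℤ) - (j : ℤ) : ℤ) : ℝ) * θ) := by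
  have hN' : (0 : ℝ) < N := by exact_mod_cast hN
  have : ∑ i ∈ Finset.range N, ∑ j ∈ Finset.range N, (1 / 2 : ℝ) = (N : ℝ) ^ 2 / 2 := by
    simp; ring
  rw [← this]
  apply Finset.sum_le_sum; intro i hi
  apply Finset.sum_le_sum; intro j hj
  rw [Finset.mem_range] at hi hj
  have h1 : |(((i : ℤ) - (j : ℤ) : ℤ) : ℝ) * θ| ≤ 1 := by
    rw [abs_mul]
    have : |(((i : ℤ) - (j : ℤ) : ℤ) : ℝ)| ≤ N := by
      rw [← Int.cast_abs]
      have : |(i : ℤ) - (j : ℤ)| ≤ N := by rw [abs_le]; constructor <;> omega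
      exact_mod_cast this
    calc _ ≤ (N : ℝ) * (1 / N) := by gcongr
      _ = 1 := mul_one_div_cancel hN'.ne'
  have h2 := Real.one_sub_sq_div_two_le_cos (x := (((i : ℤ) - (j : ℤ) : ℤ) : ℝ) * θ)
  have h3 : ((((i : ℤ) - (j : ℤ) : ℤ) : ℝ) * θ) ^ 2 ≤ 1 := by
    rw [← sq_abs]; exact pow_le_one₀ (abs_nonneg _) h1
  linarith

lemma gamma1 (N : ℕ) (hN : 1 ≤ N) :
    (N : ℝ) * √N / 20 ≤ ∑ i ∈ Finset.range N, ∑ j ∈ Finset.range N, uu ((i : ℤ) - (j : ℤ)) 0 := by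
  have hN' : (1 : ℝ) ≤ N := by exact_mod_cast hN
  set κ : ℝ := 1 / N with hκd
  have hκ : 0 < κ := by positivity
  have hκ1 : κ ≤ 1 := by rw [hκd, div_le_one (by positivity)]; exact hN'
  have hle : ∑ i ∈ Finset.range N, ∑ j ∈ Finset.range N, Vs (sk κ) ((i : ℤ) - (j : ℤ)) 0 ≤
      ∑ i ∈ Finset.range N, ∑ j ∈ Finset.range N, uu ((i : ℤ) - (j : ℤ)) 0 := by
    apply Finset.sum_le_sum; intro i _
    apply Finset.sum_le_sum; intro j _
    exact Vs_le_uu hκ _ _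
  refine le_trans ?_ hle
  have hQ := Qk_continuous hκ
  have e : ∑ i ∈ Finset.range N, ∑ j ∈ Finset.range N, Vs (sk κ) ((i : ℤ) - (j : ℤ)) 0 =
      (2 * Real.pi)⁻¹ * ∫ θ in (-Real.pi)..Real.pi,
        (∑ i ∈ Finset.range N, ∑ j ∈ Finset.range N, Real.cos ((((i : ℤ) - (j : ℤ) : ℤ) : ℝ) * θ)) * Qk κ θ := by
    simp only [Finset.sum_mul]
    rw [intervalIntegral.integral_finset_sum]
    · rw [Finset.mul_sum]
      apply Finset.sum_congr rfl; intro i _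
      rw [intervalIntegral.integral_finset_sum]
      · rw [Finset.mul_sum]
        apply Finset.sum_congr rfl; intro j _
        exact Vs_cos hκ _
      · intro j _
        exact Continuous.intervalIntegrable (by fun_prop) _ _
    · intro i _
      exact Continuous.intervalIntegrable (by fun_prop) _ _
  rw [e]
  have hpi := Real.pi_gt_three
  have hc : Continuous (fun θ => (∑ i ∈ Finset.range N, ∑ j ∈ Finset.range N,
      Real.cos ((((i : ℤ) - (j : ℤ) : ℤ) : ℝ) * θ)) * Qk κ θ) := by fun_prop
  have hI : (2 * κ) * ((N : ℝ) ^ 2 / 2 * (√N / 3)) ≤ ∫ θ in (-Real.pi)..Real.pi,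
        (∑ i ∈ Finset.range N, ∑ j ∈ Finset.range N, Real.cos ((((i : ℤ) - (j : ℤ) : ℤ) : ℝ) * θ)) * Qk κ θ := by
    have h1 := intervalIntegral.integral_mono_interval (c := -Real.pi) (a := -κ) (b := κ)
      (d := Real.pi) (μ := volume) (f := fun θ => (∑ i ∈ Finset.range N, ∑ j ∈ Finset.range N,
      Real.cos ((((i : ℤ) - (j : ℤ) : ℤ) : ℝ) * θ)) * Qk κ θ)
      (by linarith) (by linarith) (by linarith) (Eventually.of_forall (fun θ => by
        simp only [Pi.zero_apply]
        rw [cos_sum_eq]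
        have := (Qk_pos hκ θ).le
        positivity)) (hc.intervalIntegrable _ _)
    refine le_trans ?_ h1
    have h2 : ∫ θ in (-κ)..κ, ((N : ℝ) ^ 2 / 2 * (√N / 3)) = (2 * κ) * ((N : ℝ) ^ 2 / 2 * (√N / 3)) := by
      rw [intervalIntegral.integral_const, smul_eq_mul]; ring
    rw [← h2]
    apply intervalIntegral.integral_mono_on (by linarith) (by simp) (hc.intervalIntegrable _ _)
    intro θ hθ
    have hθ' : |θ| ≤ 1 / N := abs_le.mpr ⟨hθ.1, hθ.2⟩
    have hs : 0 ≤ √(N : ℝ) / 3 := by positivity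
    exact mul_le_mul (cos_sum_ge N hN hθ') (Qk_ge hκ hκ1 hN' le_rfl hθ') hs
      (le_trans (by positivity) (cos_sum_ge N hN hθ'))
  have e2 : (2 * κ) * ((N : ℝ) ^ 2 / 2 * (√N / 3)) = N * √N / 3 := by
    rw [hκd]; field_simp
  rw [e2] at hI
  have h6 : (1 : ℝ) / 6.5 ≤ (2 * Real.pi)⁻¹ := by
    rw [← one_div]; apply one_div_le_one_div_of_le (by positivity); linarith [Real.pi_lt_d2]
  calc (N : ℝ) * √N / 20 ≤ 1 / 6.5 * (N * √N / 3) := by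
        have : (0 : ℝ) ≤ N * √N := by positivity
        norm_num; linarith
    _ ≤ _ := by gcongr

lemma gamma2 (N : ℕ) (hN : 1 ≤ N) :
    √(N : ℝ) / 20 ≤ ∑ k ∈ Finset.Icc (-(N : ℤ)) N, uu k 0 := by
  have h := gamma1 N hN
  have hN' : (0 : ℝ) < N := by exact_mod_cast hN
  have h2 : ∑ i ∈ Finset.range N, ∑ j ∈ Finset.range N, uu ((i : ℤ) - (j : ℤ)) 0 ≤
      ∑ i ∈ Finset.range N, ∑ k ∈ Finset.Icc (-(N : ℤ)) N, uu k 0 := by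
    apply Finset.sum_le_sum
    intro i hi
    rw [Finset.mem_range] at hi
    have inj : Set.InjOn (fun j : ℕ => (i : ℤ) - (j : ℤ)) (Finset.range N) := by
      intro x _ y _ hxy
      simp only at hxy; omega
    rw [← Finset.sum_image (f := fun k => uu k 0) inj]
    apply Finset.sum_le_sum_of_subset_of_nonneg
    · intro k hk
      rw [Finset.mem_image] at hk
      obtain ⟨j, hj, rfl⟩ := hk
      rw [Finset.mem_range] at hj
      rw [Finset.mem_Icc]; constructor <;> omega
    · intros; exact uu_nonneg _ _
  rw [Finset.sum_const, Finset.card_range, nsmul_eq_mul] at h2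
  have h3 := h.trans h2
  rw [mul_div_assoc] at h3
  exact le_of_mul_le_mul_left h3 hN'

open MeasureTheory

lemma sup_lemma (e : ℕ → ℝ) (C : ℝ) (hC : ∀ b, e b ≤ C)
    (h : ∀ b, e b ≤ 0 ∨ ∃ c d, 3 * e b ≤ e c + e d) : ∀ b, e b ≤ 0 := by
  have key : ∀ n : ℕ, ∀ b, e b ≤ (2 / 3 : ℝ) ^ n * max C 0 := by
    intro n
    induction n with
    | zero => intro b; simp [hC b]
    | succ n ih =>
      intro b
      have h0 : 0 ≤ (2 / 3 : ℝ) ^ (n + 1) * max C 0 := by positivity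
      rcases h b with h1 | ⟨c, d, h1⟩
      · linarith
      · have := ih c
        have := ih d
        rw [pow_succ]
        linarith
  intro b
  have ht : Tendsto (fun n : ℕ => (2 / 3 : ℝ) ^ n * max C 0) atTop (nhds (0 * max C 0)) :=
    (tendsto_pow_atTop_nhds_zero_of_lt_one (by norm_num) (by norm_num)).mul_const _
  rw [zero_mul] at ht
  exact ge_of_tendsto' ht (fun n => key n b)

/-- denominator -/
def Dc (φ : ℝ) : ℝ := 3 - 2 * Real.cos φ

lemma Dc_ge (φ : ℝ) : 1 ≤ Dc φ := by unfold Dc; linarith [Real.cos_le_one φ]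
lemma Dc_pos (φ : ℝ) : 0 < Dc φ := by linarith [Dc_ge φ]
lemma Dc_cont : Continuous Dc := by unfold Dc; fun_prop

/-- integrand -/
def hi (b k : ℕ) (φ : ℝ) : ℝ := Real.sin φ * Real.sin (b * φ) * ((Dc φ)⁻¹) ^ (k + 1)

lemma hi_cont (b k : ℕ) : Continuous (hi b k) := by
  have h1 : Continuous (fun φ => (Dc φ)⁻¹) := Dc_cont.inv₀ (fun φ => (Dc_pos φ).ne')
  unfold hi
  fun_prop

lemma hi_int (b k : ℕ) (x y : ℝ) : IntervalIntegrable (hi b k) volume x y :=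
  (hi_cont b k).intervalIntegrable _ _

lemma Dinv_le (φ : ℝ) : (Dc φ)⁻¹ ≤ 1 := inv_le_one_of_one_le₀ (Dc_ge φ)
lemma Dinv_pos (φ : ℝ) : 0 < (Dc φ)⁻¹ := inv_pos.mpr (Dc_pos φ)

/-- first passage coefficients -/
def hc (b k : ℕ) : ℝ := 2 / Real.pi * ∫ φ in (0)..Real.pi, hi b k φ

lemma hc_zero (k : ℕ) : hc 0 k = 0 := by simp [hc, hi]

lemma hc_le (b k : ℕ) : hc b k ≤ 2 := by
  have hpi := Real.pi_pos
  have h1 : ∫ φ in (0)..Real.pi, hi b k φ ≤ ∫ φ in (0)..Real.pi, (1 : ℝ) := by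
    apply intervalIntegral.integral_mono_on hpi.le (hi_int _ _ _ _) (by simp)
    intro φ _
    have h2 : |hi b k φ| ≤ 1 := by
      unfold hi
      rw [abs_mul, abs_mul, abs_pow, abs_of_pos (Dinv_pos φ)]
      calc _ ≤ (1 : ℝ) * 1 * 1 := by
            gcongr
            · exact (pow_pos (Dinv_pos φ) _).le
            · exact Real.abs_sin_le_one _
            · exact Real.abs_sin_le_one _
            · exact pow_le_one₀ (Dinv_pos φ).le (Dinv_le φ)
        _ = 1 := by norm_num
    exact (le_abs_self _).trans h2
  simp at h1
  unfold hc
  calc _ ≤ 2 / Real.pi * Real.pi := by gcongr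
    _ = 2 := by field_simp

lemma hi_rec (b : ℕ) (k : ℕ) (φ : ℝ) :
    3 * hi (b + 1) k φ - hi (b + 2) k φ - hi b k φ =
      Real.sin φ * Real.sin ((b + 1 : ℕ) * φ) * ((Dc φ)⁻¹) ^ k := by
  have e1 : Real.sin ((b + 2 : ℕ) * φ) + Real.sin (b * φ) = 2 * Real.cos φ * Real.sin ((b + 1 : ℕ) * φ) := by
    have a1 : ((b + 2 : ℕ) : ℝ) * φ = (b + 1 : ℕ) * φ + φ := by push_cast; ring
    have a2 : (b : ℝ) * φ = (b + 1 : ℕ) * φ - φ := by push_cast; ring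
    rw [a1, a2, Real.sin_add, Real.sin_sub]; ring
  have e2 : (Dc φ)⁻¹ * (3 - 2 * Real.cos φ) = 1 := inv_mul_cancel₀ (Dc_pos φ).ne'
  unfold hi
  have : 3 * (Real.sin φ * Real.sin ((b + 1 : ℕ) * φ) * ((Dc φ)⁻¹) ^ (k + 1)) -
      Real.sin φ * Real.sin ((b + 2 : ℕ) * φ) * ((Dc φ)⁻¹) ^ (k + 1) -
      Real.sin φ * Real.sin (b * φ) * ((Dc φ)⁻¹) ^ (k + 1) =
      Real.sin φ * ((Dc φ)⁻¹) ^ (k + 1) * (3 * Real.sin ((b + 1 : ℕ) * φ) -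
        (Real.sin ((b + 2 : ℕ) * φ) + Real.sin (b * φ))) := by ring
  rw [this, e1, pow_succ]
  linear_combination (Real.sin φ * ((Dc φ)⁻¹) ^ k * Real.sin ((b + 1 : ℕ) * φ)) * e2

lemma hc_comb (b k : ℕ) : 3 * hc (b + 1) k - hc (b + 2) k - hc b k =
    2 / Real.pi * ∫ φ in (0)..Real.pi,
      Real.sin φ * Real.sin ((b + 1 : ℕ) * φ) * ((Dc φ)⁻¹) ^ k := by
  simp only [← hi_rec]
  rw [intervalIntegral.integral_sub (((hi_int _ _ _ _).const_mul _).sub (hi_int _ _ _ _)) (hi_int _ _ _ _),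
    intervalIntegral.integral_sub ((hi_int _ _ _ _).const_mul _) (hi_int _ _ _ _),
    intervalIntegral.integral_const_mul]
  unfold hc
  ring

lemma hc_rec (b k : ℕ) : 3 * hc (b + 1) (k + 1) = hc (b + 2) (k + 1) + hc b (k + 1) + hc (b + 1) k := by
  have h := hc_comb b (k + 1)
  have : hc (b + 1) k = 2 / Real.pi * ∫ φ in (0)..Real.pi,
      Real.sin φ * Real.sin ((b + 1 : ℕ) * φ) * ((Dc φ)⁻¹) ^ (k + 1) := rfl
  rw [← this] at h
  linarith

lemma int_cos_nat (n : ℕ) (hn : n ≠ 0) : ∫ φ in (0)..Real.pi, Real.cos (n * φ) = 0 := by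
  have hn' : (n : ℝ) ≠ 0 := by exact_mod_cast hn
  rw [intervalIntegral.integral_comp_mul_left (fun x => Real.cos x) hn']
  simp [Real.sin_nat_mul_pi]

lemma int_sin_sin (b : ℕ) : ∫ φ in (0)..Real.pi, Real.sin φ * Real.sin ((b + 1 : ℕ) * φ) =
    if b = 0 then Real.pi / 2 else 0 := by
  have e : ∀ φ : ℝ, Real.sin φ * Real.sin ((b + 1 : ℕ) * φ) =
      1 / 2 * (Real.cos (b * φ) - Real.cos ((b + 2 : ℕ) * φ)) := by
    intro φ
    have a1 : ((b + 2 : ℕ) : ℝ) * φ = (b + 1 : ℕ) * φ + φ := by push_cast; ring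
    have a2 : (b : ℝ) * φ = (b + 1 : ℕ) * φ - φ := by push_cast; ring
    rw [a1, a2, Real.cos_add, Real.cos_sub]; ring
  simp only [e]
  rw [intervalIntegral.integral_const_mul, intervalIntegral.integral_sub
    (Continuous.intervalIntegrable (by fun_prop) _ _) (Continuous.intervalIntegrable (by fun_prop) _ _),
    int_cos_nat (b + 2) (by omega)]
  split_ifs with hb
  · subst hb; simp; ring
  · rw [int_cos_nat b hb]; ring

lemma hc_rec_zero (b : ℕ) : 3 * hc (b + 1) 0 = hc (b + 2) 0 + hc b 0 + (if b = 0 then 1 else 0) := by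
  have h := hc_comb b 0
  simp only [pow_zero, mul_one] at h
  rw [int_sin_sin] at h
  have hpi := Real.pi_pos
  split_ifs at h ⊢
  · have : 2 / Real.pi * (Real.pi / 2) = 1 := by field_simp
    linarith
  · linarith

/-- extended by zero to negative arguments -/
def HH (b : ℕ) (k : ℤ) : ℝ := if 0 ≤ k then hc b k.toNat else 0

lemma HH_nat (b k : ℕ) : HH b (k : ℤ) = hc b k := by simp [HH]
lemma HH_neg (b : ℕ) {k : ℤ} (hk : k < 0) : HH b k = 0 := by
  unfold HH; rw [if_neg (by omega)]
lemma HH_zero (k : ℤ) : HH 0 k = 0 := by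
  unfold HH; split_ifs <;> simp [hc_zero]
lemma HH_le (b : ℕ) (k : ℤ) : HH b k ≤ 2 := by
  unfold HH; split_ifs
  · exact hc_le _ _
  · norm_num

lemma HH_rec (b : ℕ) (k : ℤ) : 3 * HH (b + 1) k = HH (b + 2) k + HH b k + HH (b + 1) (k - 1) +
    (if b = 0 ∧ k = 0 then 1 else 0) := by
  rcases lt_trichotomy k 0 with hk | hk | hk
  · rw [HH_neg _ hk, HH_neg _ hk, HH_neg _ hk, HH_neg _ (by omega), if_neg (by omega)]; norm_num
  · subst hk
    have := hc_rec_zero b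
    have e : ∀ b, HH b 0 = hc b 0 := fun b => HH_nat b 0
    rw [e, e, e, HH_neg _ (by omega)]
    simp only [and_true]
    linarith
  · obtain ⟨n, rfl⟩ : ∃ n : ℕ, k = ((n + 1 : ℕ) : ℤ) := ⟨k.toNat - 1, by omega⟩
    have e : ((n + 1 : ℕ) : ℤ) - 1 = (n : ℤ) := by push_cast; ring
    rw [e, HH_nat, HH_nat, HH_nat, HH_nat, if_neg (by omega), hc_rec]; ring

lemma comparison (S : Finset ℤ) (a : ℤ) (b : ℕ) (hb : 1 ≤ b) :
    ∑ j ∈ S, HH b (a - j) * uu j 0 ≤ uu a b := by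
  obtain ⟨A, hA⟩ : ∃ A : ℤ, ∀ j ∈ S, A < j := by
    rcases S.bddBelow with ⟨A, hA⟩
    exact ⟨A - 1, fun j hj => by have := hA hj; omega⟩
  have main : ∀ n : ℕ, ∀ b : ℕ, 1 ≤ b → ∑ j ∈ S, HH b (A + n - j) * uu j 0 ≤ uu (A + n) b := by
    intro n
    induction n with
    | zero =>
      intro b _
      rw [Finset.sum_eq_zero]
      · exact uu_nonneg _ _
      · intro j hj
        rw [HH_neg _ (by have := hA j hj; push_cast; omega), zero_mul]
    | succ n ih =>
      set a' : ℤ := A + (n + 1 : ℕ) with ha'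
      have ea : A + (n : ℤ) = a' - 1 := by rw [ha']; push_cast; ring
      rw [ea] at ih
      set W : ℕ → ℝ := fun b => ∑ j ∈ S, HH b (a' - j) * uu j 0 with hW
      have hWrec : ∀ b : ℕ, 3 * W (b + 1) ≤ W (b + 2) + (if b = 0 then uu a' 0 else W b) +
          ∑ j ∈ S, HH (b + 1) (a' - 1 - j) * uu j 0 := by
        intro b
        have e1 : 3 * W (b + 1) = W (b + 2) + W b + ∑ j ∈ S, HH (b + 1) (a' - 1 - j) * uu j 0 +
            ∑ j ∈ S, (if b = 0 ∧ a' - j = 0 then 1 else 0) * uu j 0 := by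
          simp only [hW]
          rw [Finset.mul_sum, ← Finset.sum_add_distrib, ← Finset.sum_add_distrib, ← Finset.sum_add_distrib]
          apply Finset.sum_congr rfl
          intro j _
          have := HH_rec b (a' - j)
          rw [show a' - j - 1 = a' - 1 - j by ring] at this
          rw [← mul_assoc, this]; ring
        rw [e1]
        by_cases hb : b = 0
        · have : W b = 0 := by rw [hb]; simp [hW, HH_zero]
          rw [if_pos hb, this]
          have h2 : ∑ j ∈ S, (if b = 0 ∧ a' - j = 0 then (1 : ℝ) else 0) * uu j 0 ≤ uu a' 0 := by
            have : ∀ j ∈ S, (if b = 0 ∧ a' - j = 0 then (1 : ℝ) else 0) * uu j 0 =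
                if a' = j then uu a' 0 else 0 := by
              intro j _
              by_cases h : a' = j
              · subst h; simp [hb]
              · have : ¬ (a' - j = 0) := by omega
                simp [h, this]
            rw [Finset.sum_congr rfl this, Finset.sum_ite_eq]
            split_ifs
            · exact le_rfl
            · exact uu_nonneg _ _
          linarith
        · rw [if_neg hb]
          simp only [hb, false_and, if_false, zero_mul, Finset.sum_const_zero]
          linarith
      have hsup := sup_lemma (fun b => if b = 0 then 0 else W b - uu a' b) (∑ j ∈ S, 2 * uu j 0)
        (by
          intro b
          have h0 : 0 ≤ ∑ j ∈ S, 2 * uu j 0 :=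
            Finset.sum_nonneg (fun j _ => mul_nonneg (by norm_num) (uu_nonneg _ _))
          have h1 : W b ≤ ∑ j ∈ S, 2 * uu j 0 :=
            Finset.sum_le_sum (fun j _ => mul_le_mul_of_nonneg_right (HH_le _ _) (uu_nonneg _ _))
          have := uu_nonneg a' b
          split_ifs <;> linarith)
        (by
          intro b
          rcases b with _ | b
          · left; simp
          · right
            refine ⟨b + 2, b, ?_⟩
            have h1 := hWrec b
            have h2 := ih (b + 1) (by omega)
            have h3 := uu_rec_pos a' b
            simp only [Nat.add_eq_zero_iff, one_ne_zero, and_false, if_false,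
              OfNat.ofNat_ne_zero]
            by_cases hb : b = 0
            · subst hb
              simp only [if_true] at h1 ⊢
              simp only [Nat.cast_zero] at h3
              linarith
            · rw [if_neg hb] at h1 ⊢
              linarith)
      intro b hb
      have := hsup b
      simp only [show b ≠ 0 by omega, if_false] at this
      linarith
  by_cases h : A ≤ a
  · obtain ⟨n, hn⟩ := Int.eq_ofNat_of_zero_le (sub_nonneg.mpr h)
    have := main n b hb
    rwa [show A + (n : ℤ) = a by omega] at this
  · rw [Finset.sum_eq_zero]
    · exact uu_nonneg _ _
    · intro j hj
      rw [HH_neg _ (by have := hA j hj; omega), zero_mul]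

/-- one step axis kernel -/
def gg (k : ℤ) : ℝ := (HH 1 k + HH 1 (-k)) / 2

lemma axis_comparison (S : Finset ℤ) (a : ℤ) : ∑ j ∈ S, gg (a - j) * uu j 0 ≤ uu a 0 := by
  have h1 := comparison S a 1 le_rfl
  have h2 := comparison (S.image (fun j => -j)) (-a) 1 le_rfl
  rw [Finset.sum_image (by intro x _ y _ h; simpa using h)] at h2
  have h3 := uu_axis a
  have e : ∀ j, uu (-j) 0 = uu j 0 := fun j => by have := uu_symm j 0; simpa using this
  simp only [e, Nat.cast_one] at h1 h2
  have : ∑ j ∈ S, gg (a - j) * uu j 0 = (∑ j ∈ S, HH 1 (a - j) * uu j 0 +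
      ∑ j ∈ S, HH 1 (-a - -j) * uu j 0) / 2 := by
    rw [← Finset.sum_add_distrib, Finset.sum_div]
    apply Finset.sum_congr rfl
    intro j _
    unfold gg
    rw [show -(a - j) = -a - -j by ring]; ring
  rw [this]
  linarith

open MeasureTheory

lemma hi_one_nonneg (k : ℕ) (φ : ℝ) : 0 ≤ hi 1 k φ := by
  unfold hi
  have := Dinv_pos φ
  rw [Nat.cast_one, one_mul]
  exact mul_nonneg (mul_self_nonneg _) (by positivity)

lemma hc_nonneg (k : ℕ) : 0 ≤ hc 1 k := by
  unfold hc
  apply mul_nonneg (by have := Real.pi_pos; positivity)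
  exact intervalIntegral.integral_nonneg Real.pi_pos.le (fun φ _ => hi_one_nonneg k φ)

lemma HH_one_nonneg (k : ℤ) : 0 ≤ HH 1 k := by
  unfold HH; split_ifs
  · exact hc_nonneg _
  · exact le_rfl

lemma gg_nonneg (k : ℤ) : 0 ≤ gg k := by
  unfold gg; linarith [HH_one_nonneg k, HH_one_nonneg (-k)]

lemma hc_lower (k : ℕ) : 1 / (72 * (((k : ℝ) + 1) * √((k : ℝ) + 1))) ≤ hc 1 k := by
  set n : ℝ := (k : ℝ) + 1 with hn
  have hn1 : 1 ≤ n := by rw [hn]; linarith [(Nat.cast_nonneg k : (0 : ℝ) ≤ k)]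
  have hs1 : 1 ≤ √n := by rw [Real.one_le_sqrt]; exact hn1
  have hs2 : √n * √n = n := Real.mul_self_sqrt (by linarith)
  set r : ℝ := 1 / √n with hr
  have hr0 : 0 < r := by positivity
  have hr1 : r ≤ 1 := by rw [hr, div_le_one (by positivity)]; exact hs1
  have hrr : r ^ 2 = 1 / n := by rw [hr, div_pow, sq (√n), hs2, one_pow]
  have hpi := Real.pi_gt_three
  have hI : r ^ 3 / 36 ≤ ∫ φ in (0)..Real.pi, hi 1 k φ := by
    have h1 := intervalIntegral.integral_mono_interval (c := 0) (a := 0) (b := r)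
      (d := Real.pi) (μ := volume) (f := hi 1 k) le_rfl hr0.le (by linarith)
      (Eventually.of_forall (fun φ => hi_one_nonneg k φ)) (hi_int _ _ _ _)
    refine le_trans ?_ h1
    have h2 : ∫ φ in (0)..r, φ ^ 2 / 12 = r ^ 3 / 36 := by
      rw [intervalIntegral.integral_div, integral_pow]; norm_num; ring
    rw [← h2]
    apply intervalIntegral.integral_mono_on hr0.le
      (Continuous.intervalIntegrable (by fun_prop) _ _) (hi_int _ _ _ _)
    intro φ hφ
    obtain ⟨hφ0, hφr⟩ := hφ
    have hs : φ / 2 ≤ Real.sin φ := by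
      have := Real.mul_le_sin hφ0 (by linarith)
      refine le_trans ?_ this
      have h4 : (1 : ℝ) / 2 ≤ 2 / Real.pi := by
        rw [div_le_div_iff₀ (by norm_num) (by positivity)]; linarith [Real.pi_le_four]
      nlinarith
    have hD : Dc φ ≤ 1 + 1 / n := by
      unfold Dc
      have h5 := Real.one_sub_sq_div_two_le_cos (x := φ)
      have : φ ^ 2 ≤ r ^ 2 := by gcongr
      rw [hrr] at this
      linarith
    have hDp : (Dc φ) ^ (k + 1) ≤ 3 := by
      calc (Dc φ) ^ (k + 1) ≤ (Real.exp (1 / n)) ^ (k + 1) := by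
            apply pow_le_pow_left₀ (Dc_pos φ).le
            linarith [Real.add_one_le_exp (1 / n)]
        _ = Real.exp 1 := by
            rw [← Real.exp_nat_mul]; congr 1; push_cast; rw [← hn]; field_simp
        _ ≤ 3 := Real.exp_one_lt_three.le
    unfold hi
    rw [Nat.cast_one, one_mul, inv_pow]
    have h6 : (3 : ℝ)⁻¹ ≤ ((Dc φ) ^ (k + 1))⁻¹ := by
      apply inv_anti₀ (pow_pos (Dc_pos φ) _) hDp
    have hs0 : 0 ≤ Real.sin φ := by linarith
    calc φ ^ 2 / 12 = (φ / 2) * (φ / 2) * 3⁻¹ := by ring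
      _ ≤ _ := by gcongr
  unfold hc
  have h4 : (1 : ℝ) / 2 ≤ 2 / Real.pi := by
    rw [div_le_div_iff₀ (by norm_num) (by positivity)]; linarith [Real.pi_le_four]
  calc 1 / (72 * (n * √n)) = 1 / 2 * (r ^ 3 / 36) := by
        rw [pow_succ, hrr, hr]; field_simp; norm_num
    _ ≤ _ := by gcongr

lemma hi_sum (K : ℕ) (φ : ℝ) : ∑ k ∈ Finset.range K, hi 1 k φ =
    (1 + Real.cos φ) / 2 * (1 - ((Dc φ)⁻¹) ^ K) := by
  induction K with
  | zero => simp
  | succ K ih =>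
    rw [Finset.sum_range_succ, ih]
    unfold hi
    rw [Nat.cast_one, one_mul]
    have e2 : (Dc φ)⁻¹ * (3 - 2 * Real.cos φ) = 1 := inv_mul_cancel₀ (Dc_pos φ).ne'
    have e3 := Real.sin_sq_add_cos_sq φ
    rw [pow_succ]
    linear_combination ((Dc φ)⁻¹ ^ K * (Dc φ)⁻¹) * e3 + (1 + Real.cos φ) / 2 * ((Dc φ)⁻¹) ^ K * e2

lemma int_tail : Tendsto (fun K : ℕ => ∫ φ in (0)..Real.pi, (1 + Real.cos φ) / 2 * (1 - ((Dc φ)⁻¹) ^ K))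
    atTop (nhds (∫ φ in (0)..Real.pi, (1 + Real.cos φ) / 2)) := by
  have hD : Continuous (fun φ => (Dc φ)⁻¹) := Dc_cont.inv₀ (fun φ => (Dc_pos φ).ne')
  apply intervalIntegral.tendsto_integral_filter_of_dominated_convergence (fun _ => (1 : ℝ))
  · refine Eventually.of_forall (fun K => ?_)
    exact (by fun_prop : Continuous fun φ => (1 + Real.cos φ) / 2 * (1 - ((Dc φ)⁻¹) ^ K)).aestronglyMeasurable
  · refine Eventually.of_forall (fun K => Eventually.of_forall (fun φ _ => ?_))
    have h1 := Real.cos_le_one φ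
    have h2 := Real.neg_one_le_cos φ
    have h3 := pow_le_one₀ (n := K) (Dinv_pos φ).le (Dinv_le φ)
    have h4 := pow_pos (Dinv_pos φ) K
    rw [Real.norm_of_nonneg (mul_nonneg (by linarith) (by linarith))]
    nlinarith
  · simp
  · refine Eventually.of_forall (fun φ hφ => ?_)
    rw [Set.uIoc_of_le Real.pi_pos.le] at hφ
    have hlt : (Dc φ)⁻¹ < 1 := by
      apply inv_lt_one_of_one_lt₀
      unfold Dc
      have : Real.cos φ < 1 := by
        rw [← Real.cos_zero]
        exact Real.cos_lt_cos_of_nonneg_of_le_pi le_rfl hφ.2 hφ.1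
      linarith
    have := ((tendsto_pow_atTop_nhds_zero_of_lt_one (Dinv_pos φ).le hlt).const_sub 1).const_mul
      ((1 + Real.cos φ) / 2)
    simpa using this

lemma hc_sum : Tendsto (fun K : ℕ => ∑ k ∈ Finset.range K, hc 1 k) atTop (nhds 1) := by
  have h := int_tail.const_mul (2 / Real.pi)
  have e : 2 / Real.pi * (∫ φ in (0)..Real.pi, (1 + Real.cos φ) / 2) = 1 := by
    rw [intervalIntegral.integral_div, intervalIntegral.integral_add (by simp)
      (Continuous.intervalIntegrable (by fun_prop) _ _), integral_cos]
    have := Real.pi_pos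
    simp
  rw [e] at h
  refine h.congr (fun K => ?_)
  unfold hc
  rw [← Finset.mul_sum, ← intervalIntegral.integral_finsetSum (fun k _ => hi_int _ _ _ _)]
  simp only [hi_sum]

lemma gg_lower (k : ℤ) (N : ℝ) (hk : |(k : ℝ)| + 1 ≤ N) : 1 / (144 * (N * √N)) ≤ gg k := by
  have key : ∀ n : ℕ, (n : ℝ) + 1 ≤ N → 1 / (72 * (N * √N)) ≤ hc 1 n := by
    intro n hn
    refine le_trans ?_ (hc_lower n)
    apply one_div_le_one_div_of_le (by positivity)
    have hN0 : 0 ≤ N := by linarith [(Nat.cast_nonneg n : (0 : ℝ) ≤ n)]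
    gcongr
  have h2 : 1 / (72 * (N * √N)) ≤ HH 1 k + HH 1 (-k) := by
    rcases le_total 0 k with h | h
    · obtain ⟨n, rfl⟩ := Int.eq_ofNat_of_zero_le h
      have := key n (by simpa using hk)
      rw [HH_nat]; linarith [HH_one_nonneg (-(n : ℤ))]
    · obtain ⟨n, hn⟩ := Int.eq_ofNat_of_zero_le (neg_nonneg.mpr h)
      have hk' : k = -(n : ℤ) := by omega
      subst hk'
      have := key n (by simpa using hk)
      rw [neg_neg, HH_nat]; linarith [HH_one_nonneg (-(n : ℤ))]
  unfold gg
  have : 1 / (144 * (N * √N)) = 1 / (72 * (N * √N)) / 2 := by rw [div_div]; ring_nf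
  rw [this]; linarith

lemma gg_sum (K : ℕ) : ∑ i ∈ Finset.Ioo (-(K : ℤ)) K, gg i = ∑ k ∈ Finset.range K, hc 1 k := by
  have h1 : ∑ i ∈ Finset.Ioo (-(K : ℤ)) K, HH 1 i = ∑ k ∈ Finset.range K, hc 1 k := by
    have : ∑ k ∈ Finset.range K, hc 1 k = ∑ i ∈ (Finset.range K).image (fun k : ℕ => (k : ℤ)), HH 1 i := by
      rw [Finset.sum_image (by intro x _ y _ h; simpa using h)]
      simp only [HH_nat]
    rw [this]
    symm
    apply Finset.sum_subset
    · intro i hi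
      rw [Finset.mem_image] at hi
      obtain ⟨k, hk, rfl⟩ := hi
      rw [Finset.mem_range] at hk
      rw [Finset.mem_Ioo]; constructor <;> omega
    · intro i hi hni
      apply HH_neg
      by_contra hc
      apply hni
      rw [Finset.mem_image]
      rw [Finset.mem_Ioo] at hi
      exact ⟨i.toNat, by rw [Finset.mem_range]; omega, by omega⟩
  have h2 : ∑ i ∈ Finset.Ioo (-(K : ℤ)) K, HH 1 (-i) = ∑ i ∈ Finset.Ioo (-(K : ℤ)) K, HH 1 i := by
    apply Finset.sum_nbij' (fun i => -i) (fun i => -i)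
    · intro i hi; rw [Finset.mem_Ioo] at hi ⊢; constructor <;> omega
    · intro i hi; rw [Finset.mem_Ioo] at hi ⊢; constructor <;> omega
    · intro i _; simp
    · intro i _; simp
    · intro i _; rfl
  unfold gg
  rw [← Finset.sum_div, Finset.sum_add_distrib, h2, h1]; ring

open MeasureTheory

lemma far_bound (a : ℕ) (ha : 2 ≤ a) :
    1 / 20000 / (a : ℝ) ≤ ∑ j ∈ Finset.Icc (-((a / 2 : ℕ) : ℤ)) ((a / 2 : ℕ) : ℤ), gg (a - j) * uu j 0 := by
  set N : ℕ := a / 2 with hN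
  have hN1 : 1 ≤ N := by omega
  have ha' : (0 : ℝ) < a := by positivity
  have h1 := gamma2 N hN1
  have h2 : ∀ j ∈ Finset.Icc (-(N : ℤ)) (N : ℤ), 1 / (144 * ((2 * a : ℝ) * √(2 * a))) * uu j 0 ≤ gg (a - j) * uu j 0 := by
    intro j hj
    rw [Finset.mem_Icc] at hj
    apply mul_le_mul_of_nonneg_right _ (uu_nonneg _ _)
    apply gg_lower
    have : |((a : ℤ) - j)| + 1 ≤ 2 * (a : ℤ) := by
      rw [abs_of_nonneg (by omega)]; omega
    exact_mod_cast this
  refine le_trans ?_ (Finset.sum_le_sum h2)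
  rw [← Finset.mul_sum]
  have h3 : √(2 * a : ℝ) ≤ 3 * √(N : ℝ) := by
    rw [Real.sqrt_le_left (by positivity), mul_pow, Real.sq_sqrt (by positivity)]
    have : 2 * a ≤ 9 * N := by omega
    have : (2 : ℝ) * a ≤ 9 * N := by exact_mod_cast this
    linarith
  have hs : 0 < √(2 * a : ℝ) := by positivity
  calc 1 / 20000 / (a : ℝ) ≤ 1 / (144 * ((2 * a : ℝ) * √(2 * a))) * (√(N : ℝ) / 20) := by
        rw [div_div, div_mul_div_comm, div_le_div_iff₀ (by positivity) (by positivity)]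
        nlinarith [mul_le_mul_of_nonneg_left h3 ha'.le]
    _ ≤ _ := by gcongr

lemma L_step (L : ℝ) (hL : 0 ≤ L) (h : ∃ A : ℕ, ∀ a : ℕ, A ≤ a → L ≤ a * uu a 0) :
    ∃ A : ℕ, ∀ a : ℕ, A ≤ a → L + 1 / 40000 ≤ a * uu a 0 := by
  obtain ⟨A, hA⟩ := h
  set ε : ℝ := 1 / 80000 / (L + 1) with hε
  have hε0 : 0 < ε := by positivity
  have hLε : L * ε ≤ 1 / 80000 := by
    rw [hε, mul_div_assoc', div_le_iff₀ (by linarith)]; nlinarith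
  have hε1 : ε ≤ 1 := by
    rw [hε, div_le_iff₀ (by linarith)]; linarith
  obtain ⟨K, hK⟩ := (hc_sum.eventually (lt_mem_nhds (show 1 - ε < 1 by linarith))).exists
  obtain ⟨B, hB⟩ := exists_nat_ge (80000 * L * K)
  refine ⟨A + 2 * K + B + 2, fun a ha => ?_⟩
  have ha0 : (0 : ℝ) < a := by
    have : 0 < a := by omega
    exact_mod_cast this
  have hfar := far_bound a (by omega)
  set N : ℕ := a / 2 with hN
  have hdisj : Disjoint (Finset.Icc (-(N : ℤ)) (N : ℤ)) (Finset.Ioo ((a : ℤ) - K) (a + K)) := by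
    rw [Finset.disjoint_left]
    intro j h1 h2
    rw [Finset.mem_Icc] at h1
    rw [Finset.mem_Ioo] at h2
    omega
  have hcomp := axis_comparison (Finset.Icc (-(N : ℤ)) (N : ℤ) ∪ Finset.Ioo ((a : ℤ) - K) (a + K)) a
  rw [Finset.sum_union hdisj] at hcomp
  have hK0 : (0 : ℝ) ≤ K := Nat.cast_nonneg K
  have hnear : (1 - ε) * (L / (a + K)) ≤ ∑ j ∈ Finset.Ioo ((a : ℤ) - K) (a + K), gg (a - j) * uu j 0 := by
    have h1 : ∀ j ∈ Finset.Ioo ((a : ℤ) - K) (a + K), gg (a - j) * (L / (a + K)) ≤ gg (a - j) * uu j 0 := by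
      intro j hj
      rw [Finset.mem_Ioo] at hj
      apply mul_le_mul_of_nonneg_left _ (gg_nonneg _)
      obtain ⟨n, rfl⟩ := Int.eq_ofNat_of_zero_le (show 0 ≤ j by omega)
      have h2 := hA n (by omega)
      have h3 : n ≤ a + K := by omega
      have h3' : (n : ℝ) ≤ a + K := by exact_mod_cast h3
      rw [div_le_iff₀ (by linarith)]
      nlinarith [uu_nonneg n 0]
    refine le_trans ?_ (Finset.sum_le_sum h1)
    rw [← Finset.sum_mul]
    have h4 : ∑ j ∈ Finset.Ioo ((a : ℤ) - K) (a + K), gg (a - j) = ∑ k ∈ Finset.range K, hc 1 k := by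
      rw [← gg_sum]
      apply Finset.sum_nbij' (fun j : ℤ => (a : ℤ) - j) (fun j : ℤ => (a : ℤ) - j)
      · intro i hi; rw [Finset.mem_Ioo] at hi ⊢; constructor <;> omega
      · intro i hi; rw [Finset.mem_Ioo] at hi ⊢; constructor <;> omega
      · intro i _; simp
      · intro i _; simp
      · intro i _; rfl
    rw [h4]
    gcongr
  have h5 : 1 / 20000 / (a : ℝ) + (1 - ε) * (L / (a + K)) ≤ uu a 0 := by linarith
  have h6 := mul_le_mul_of_nonneg_left h5 ha0.le
  refine le_trans ?_ h6
  have e1 : (a : ℝ) * (1 / 20000 / (a : ℝ)) = 1 / 20000 := by field_simp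
  have hη : L - 1 / 80000 ≤ a * (L / (a + K)) := by
    rw [mul_div_assoc', le_div_iff₀ (by linarith)]
    have hBa : B ≤ a := by omega
    have hBa' : (B : ℝ) ≤ a := by exact_mod_cast hBa
    nlinarith
  have hη2 : a * (L / (a + K)) ≤ L := by
    rw [mul_div_assoc', div_le_iff₀ (by linarith)]
    nlinarith
  rw [mul_add, e1]
  have : (a : ℝ) * ((1 - ε) * (L / (a + K))) = a * (L / (a + K)) - ε * (a * (L / (a + K))) := by ring
  rw [this]
  nlinarith

lemma L_all (R : ℝ) : ∃ A : ℕ, ∀ a : ℕ, A ≤ a → R ≤ a * uu a 0 := by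
  have key : ∀ n : ℕ, ∃ A : ℕ, ∀ a : ℕ, A ≤ a → (n : ℝ) / 40000 ≤ a * uu a 0 := by
    intro n
    induction n with
    | zero => exact ⟨0, fun a _ => by simp; exact mul_nonneg (Nat.cast_nonneg _) (uu_nonneg _ _)⟩
    | succ n ih =>
      have := L_step _ (by positivity) ih
      push_cast
      rwa [add_div]
  obtain ⟨n, hn⟩ := exists_nat_ge (40000 * R)
  obtain ⟨A, hA⟩ := key n
  exact ⟨A, fun a ha => le_trans (by linarith) (hA a ha)⟩

lemma uu_axis_symm (k : ℤ) : uu (-k) 0 = uu k 0 := by have := uu_symm k 0; simpa using this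

lemma axis_pos (k : ℤ) : 0 < uu k 0 := by
  have h := axis_comparison {0} k
  rw [Finset.sum_singleton, sub_zero] at h
  have h1 := gg_lower k (|(k : ℝ)| + 1) le_rfl
  have h2 : 0 < 1 / (144 * ((|(k : ℝ)| + 1) * √(|(k : ℝ)| + 1))) := by positivity
  have := uu_zero_pos
  nlinarith

lemma axis_large (R : ℝ) : ∃ N0 : ℝ, 1 ≤ N0 ∧ ∀ N : ℝ, N0 ≤ N → ∀ k : ℤ, |(k : ℝ)| ≤ N → R ≤ N * uu k 0 := by
  obtain ⟨A, hA⟩ := L_all R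
  obtain ⟨m, hm, hmk⟩ : ∃ m : ℝ, 0 < m ∧ ∀ n : ℕ, n < A → m ≤ uu n 0 := by
    clear hA
    induction A with
    | zero => exact ⟨1, one_pos, fun n hn => by omega⟩
    | succ A ih =>
      obtain ⟨m, hm, h⟩ := ih
      refine ⟨min m (uu A 0), lt_min hm (axis_pos _), fun n hn => ?_⟩
      rcases Nat.lt_succ_iff_lt_or_eq.mp hn with h1 | h1
      · exact (min_le_left _ _).trans (h n h1)
      · subst h1; exact min_le_right _ _
  refine ⟨max 1 (R / m), le_max_left _ _, fun N hN k hk => ?_⟩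
  have hN1 : 1 ≤ N := (le_max_left _ _).trans hN
  have hN2 : R ≤ N * m := by
    rw [← div_le_iff₀ hm]; exact (le_max_right _ _).trans hN
  have key : ∀ n : ℕ, (n : ℝ) ≤ N → R ≤ N * uu n 0 := by
    intro n hn
    by_cases h : n < A
    · have := hmk n h
      nlinarith
    · have := hA n (by omega)
      have := uu_nonneg n 0
      nlinarith
  rcases le_total 0 k with h | h
  · obtain ⟨n, rfl⟩ := Int.eq_ofNat_of_zero_le h
    exact key n (by simpa using hk)
  · obtain ⟨n, hn⟩ := Int.eq_ofNat_of_zero_le (neg_nonneg.mpr h)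
    have hk' : k = -(n : ℤ) := by omega
    subst hk'
    rw [uu_axis_symm]
    exact key n (by simpa using hk)

lemma off_axis (a : ℤ) (b : ℕ) (hb : 1 ≤ b) (m : ℝ) (hm : 0 ≤ m)
    (h : ∀ k : ℤ, a - 2 * (b : ℤ) ^ 2 ≤ k → k ≤ a → m ≤ uu k 0) : m / 4 ≤ uu a b := by
  have hb' : (0 : ℝ) < b := by exact_mod_cast hb
  set T : ℕ := 2 * b ^ 2 with hT
  have hT' : (T : ℝ) = 2 * (b : ℝ) ^ 2 := by rw [hT]; push_cast; ring
  set v : ℝ → ℝ → ℝ := fun t β => m * (t / T - 1 + (1 - β / (2 * b)) ^ 2) with hv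
  have main : ∀ t : ℕ, t ≤ T → ∀ β : ℕ, β ≤ 2 * b → v t β ≤ uu (a - T + t) β := by
    intro t
    induction t with
    | zero =>
      intro _ β hβ
      have hβ' : (β : ℝ) ≤ 2 * b := by exact_mod_cast hβ
      refine le_trans ?_ (uu_nonneg _ _)
      simp only [hv, Nat.cast_zero, zero_div]
      have h1 : (β : ℝ) / (2 * b) ≤ 1 := by rw [div_le_one (by positivity)]; exact hβ'
      have h2 : 0 ≤ (β : ℝ) / (2 * b) := by positivity
      apply mul_nonpos_of_nonneg_of_nonpos hm
      nlinarith
    | succ t ih =>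
      intro ht
      have ih' := ih (by omega)
      have htT : ((t + 1 : ℕ) : ℝ) ≤ T := by exact_mod_cast ht
      have hTpos : (0 : ℝ) < T := by rw [hT']; positivity
      have htT' : ((t + 1 : ℕ) : ℝ) / T ≤ 1 := by rw [div_le_one hTpos]; exact htT
      set a' : ℤ := a - T + (t + 1 : ℕ) with ha'
      have ea : a - T + (t : ℤ) = a' - 1 := by rw [ha']; push_cast; ring
      rw [ea] at ih'
      have h0 : v (t + 1 : ℕ) 0 ≤ uu a' 0 := by
        have h1 : m ≤ uu a' 0 := by
          apply h
          · rw [ha', hT]; push_cast; omega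
          · rw [ha']; have : ((t + 1 : ℕ) : ℤ) ≤ T := by exact_mod_cast ht
            omega
        refine le_trans ?_ h1
        simp only [hv, zero_div, sub_zero, one_pow, sub_add_cancel]
        nlinarith
      have hB : v (t + 1 : ℕ) (2 * b : ℕ) ≤ uu a' (2 * b : ℕ) := by
        refine le_trans ?_ (uu_nonneg _ _)
        simp only [hv]
        push_cast at htT' ⊢
        rw [div_self (by positivity)]
        apply mul_nonpos_of_nonneg_of_nonpos hm
        linarith
      have hrec : ∀ β : ℕ, 3 * v (t + 1 : ℕ) (β + 1 : ℕ) = v (t + 1 : ℕ) (β + 2 : ℕ) + v (t + 1 : ℕ) β +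
          v t (β + 1 : ℕ) := by
        intro β
        simp only [hv]
        rw [hT']
        push_cast
        field_simp
        ring
      have hsup := sup_lemma (fun β => if β ≤ 2 * b then v (t + 1 : ℕ) β - uu a' β else 0) (2 * m)
        (by
          intro β
          split_ifs with hβ
          · have hβ' : (β : ℝ) ≤ 2 * b := by exact_mod_cast hβ
            have h1 : (β : ℝ) / (2 * b) ≤ 1 := by rw [div_le_one (by positivity)]; exact hβ'
            have h2 : 0 ≤ (β : ℝ) / (2 * b) := by positivity
            have h3 : v (t + 1 : ℕ) β ≤ m * 2 := by
              simp only [hv]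
              apply mul_le_mul_of_nonneg_left _ hm
              nlinarith
            linarith [uu_nonneg a' β]
          · linarith)
        (by
          intro β
          rcases β with _ | β
          · left
            simp only [Nat.zero_le, if_true, Nat.cast_zero] at h0 ⊢
            linarith
          · by_cases h1 : β + 1 < 2 * b
            · right
              refine ⟨β + 2, β, ?_⟩
              rw [if_pos (by omega), if_pos (by omega), if_pos (by omega)]
              have h2 := hrec β
              have h3 := uu_rec_pos a' β
              have h4 := ih' (β + 1) (by omega)
              linarith
            · left
              split_ifs with h2
              · have h3 : β + 1 = 2 * b := by omega
                rw [h3]; linarith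
              · exact le_rfl)
      intro β hβ
      have := hsup β
      simp only [hβ, if_true] at this
      linarith
  have := main T le_rfl b (by omega)
  rw [sub_add_cancel] at this
  refine le_trans (le_of_eq ?_) this
  simp only [hv]
  rw [hT']
  field_simp
  norm_num

lemma MM_uu_large (R : ℝ) (hR : 0 ≤ R) : ∃ M0 : ℝ, ∀ a b : ℤ, M0 ≤ MM a b → R ≤ MM a b * uu a b := by
  obtain ⟨N0, hN0, h⟩ := axis_large (12 * R)
  refine ⟨N0, ?_⟩
  have key : ∀ (a : ℤ) (b : ℕ), N0 ≤ MM a b → R ≤ MM a b * uu a b := by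
    intro a b hM
    have hM1 := MM_pos a b
    have hk : ∀ k : ℤ, |(k : ℝ)| ≤ 3 * MM a b → 4 * R / MM a b ≤ uu k 0 := by
      intro k hk
      have := h (3 * MM a b) (by linarith) k hk
      rw [div_le_iff₀ (by linarith)]
      linarith
    have h4 : R / MM a b = 4 * R / MM a b / 4 := by ring
    have : R / MM a b ≤ uu a b := by
      rcases Nat.eq_zero_or_pos b with hb | hb
      · subst hb
        have h1 := hk a (by
          unfold MM; have := abs_nonneg (a : ℝ); simp; linarith)
        have h0 : 0 ≤ 4 * R / MM a (0 : ℕ) := div_nonneg (by linarith) (by linarith)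
        simp only [Nat.cast_zero] at *
        linarith
      · rw [h4]
        apply off_axis a b hb _ (div_nonneg (by linarith) (by linarith))
        intro k hk1 hk2
        apply hk
        have h1 : (a : ℝ) - 2 * (b : ℝ) ^ 2 ≤ k := by exact_mod_cast hk1
        have h2 : (k : ℝ) ≤ a := by exact_mod_cast hk2
        have h3 := neg_abs_le (a : ℝ)
        have h5 := le_abs_self (a : ℝ)
        have h6 := abs_nonneg (a : ℝ)
        have h7 := sq_nonneg (b : ℝ)
        unfold MM
        rw [Int.cast_natCast, abs_le]
        constructor <;> linarith
    rw [div_le_iff₀ (by linarith)] at this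
    linarith
  intro a b hM
  rcases le_total 0 b with hb | hb
  · obtain ⟨n, rfl⟩ := Int.eq_ofNat_of_zero_le hb
    exact key a n hM
  · obtain ⟨n, hn⟩ := Int.eq_ofNat_of_zero_le (neg_nonneg.mpr hb)
    have e : MM a b = MM (-a) n := by
      rw [← hn]; unfold MM; push_cast; rw [abs_neg, neg_sq]
    rw [e] at hM ⊢
    rw [← uu_symm a b, hn]
    exact key (-a) n hM

/-- the filter at infinity -/
def linf : Filter (ℤ × ℤ) := Filter.comap (fun y : ℤ × ℤ => |y.1| + |y.2|) Filter.atTop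

lemma linf_shift (c : ℤ) : Tendsto (fun y : ℤ × ℤ => (y.1 + c, y.2)) linf linf := by
  unfold linf
  rw [tendsto_comap_iff]
  have h : Tendsto (fun y : ℤ × ℤ => |y.1| + |y.2| + (-|c|))
      (Filter.comap (fun y : ℤ × ℤ => |y.1| + |y.2|) Filter.atTop) atTop :=
    tendsto_atTop_add_const_right _ _ tendsto_comap
  refine tendsto_atTop_mono (fun y => ?_) h
  have := abs_sub_abs_le_abs_sub y.1 (-c)
  rw [abs_neg, sub_neg_eq_add] at this
  simp only [Function.comp_apply]
  omega

lemma MM_tendsto : Tendsto (fun y : ℤ × ℤ => MM y.1 y.2) linf atTop := by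
  have h : Tendsto (fun y : ℤ × ℤ => ((|y.1| + |y.2| : ℤ) : ℝ)) linf atTop :=
    tendsto_intCast_atTop_atTop.comp tendsto_comap
  refine tendsto_atTop_mono (fun y => ?_) h
  unfold MM
  push_cast
  have : |(y.2 : ℝ)| ≤ (y.2 : ℝ) ^ 2 + 1 := by
    rw [← sq_abs]; nlinarith [sq_nonneg (|(y.2 : ℝ)| - 1)]
  linarith

lemma uu_ev_pos : ∀ᶠ y : ℤ × ℤ in linf, 0 < uu y.1 y.2 := by
  obtain ⟨M0, h⟩ := MM_uu_large 1 zero_le_one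
  filter_upwards [MM_tendsto.eventually_ge_atTop M0] with y hy
  have h1 := h y.1 y.2 hy
  have h2 := MM_pos y.1 y.2
  by_contra hc
  nlinarith

lemma ratio_one : Tendsto (fun y : ℤ × ℤ => uu (y.1 - 1) y.2 / uu y.1 y.2) linf (nhds 1) := by
  rw [Metric.tendsto_nhds]
  intro ε hε
  have hC := CD_pos
  obtain ⟨M0, h⟩ := MM_uu_large (2 * CD / ε) (by positivity)
  filter_upwards [MM_tendsto.eventually_ge_atTop M0, uu_ev_pos] with y hy hp
  have h1 := h y.1 y.2 hy
  have h2 := MM_pos y.1 y.2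
  have h3 := uu_diff y.1 y.2
  rw [Real.dist_eq, div_sub_one hp.ne', abs_div, abs_of_pos hp, div_lt_iff₀ hp, abs_sub_comm]
  rw [div_le_iff₀ hε] at h1
  have : MM y.1 y.2 * |uu y.1 y.2 - uu (y.1 - 1) y.2| < MM y.1 y.2 * (ε * uu y.1 y.2) := by
    linarith
  exact lt_of_mul_lt_mul_left this (by linarith)

lemma ratio_nat (n : ℕ) : Tendsto (fun y : ℤ × ℤ => uu (y.1 - n) y.2 / uu y.1 y.2) linf (nhds 1) := by
  induction n with
  | zero =>
    refine Tendsto.congr' ?_ tendsto_const_nhds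
    filter_upwards [uu_ev_pos] with y hy
    simp [div_self hy.ne']
  | succ n ih =>
    have h1 := (ih.comp (linf_shift (-1))).mul ratio_one
    rw [one_mul] at h1
    refine h1.congr' ?_
    filter_upwards [uu_ev_pos, (linf_shift (-1)).eventually uu_ev_pos] with y hy hy2
    simp only [Function.comp_apply] at hy2 ⊢
    rw [← sub_eq_add_neg] at hy2 ⊢
    rw [div_mul_div_cancel₀ hy2.ne']
    push_cast
    rw [show y.1 - 1 - (n : ℤ) = y.1 - (n + 1) by ring]

lemma ratio_int (z : ℤ) : Tendsto (fun y : ℤ × ℤ => uu (y.1 - z) y.2 / uu y.1 y.2) linf (nhds 1) := by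
  rcases le_total 0 z with hz | hz
  · obtain ⟨n, rfl⟩ := Int.eq_ofNat_of_zero_le hz
    exact ratio_nat n
  · obtain ⟨n, hn⟩ := Int.eq_ofNat_of_zero_le (neg_nonneg.mpr hz)
    have hz' : z = -(n : ℤ) := by omega
    subst hz'
    have h := ((ratio_nat n).comp (linf_shift n)).inv₀ one_ne_zero
    rw [inv_one] at h
    refine h.congr (fun y => ?_)
    simp only [Function.comp_apply, inv_div, add_sub_cancel_right, sub_neg_eq_add]

end HelperLemmas

/-- For every `z` on the horizontal axis, the Martin kernel
`K((z,0),y) = G((z,0),y)/G((0,0),y)` of the simple random walk on ℍ tends to `1`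
as `|y₁| + |y₂| → ∞`. -/
theorem martin_kernel_axis_tendsto_one (z : ℤ) :
    Tendsto (fun y : ℤ × ℤ => greenFn (z, 0) y / greenFn (0, 0) y)
      (Filter.comap (fun y : ℤ × ℤ => |y.1| + |y.2|) Filter.atTop) (nhds 1) := by
  refine (ratio_int z).congr (fun y => ?_)
  obtain ⟨a, b⟩ := y
  rw [greenFn_eq, greenFn_eq, sub_zero, mul_div_mul_left _ _ (wt_pos b).ne']
end
end

section
/- For every λ ∈ ℝ, the function u ↦ e^{i u λ} · exp(−2 e^{i·sgn(u)·π/4}·√|u|)/√|u| is (Lebesgue) integrable on ℝ, and its integral s(λ) = ∫_{−∞}^{∞} e^{i u λ} · exp(−2 e^{i·sgn(u)·π/4}·√|u|)/√|u| du is nonzero. -/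
open MeasureTheory Real

noncomputable section

open Filter Topology Set

/-- The entire function whose integral on the positive half line is computed by rotation. -/
def auxF (lam : ℝ) (z : ℂ) : ℂ :=
  Complex.exp (Complex.I * lam * z ^ 2 - (√2 : ℝ) * (1 + Complex.I) * z)

lemma auxF_differentiable (lam : ℝ) : Differentiable ℂ (auxF lam) := by
  unfold auxF; fun_prop

lemma auxF_norm (lam : ℝ) (z : ℂ) :
    ‖auxF lam z‖ = Real.exp (-2 * lam * z.re * z.im - √2 * (z.re - z.im)) := by
  rw [auxF, Complex.norm_exp]
  congr 1
  simp [pow_two]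
  ring

lemma auxF_integrableOn (lam : ℝ) : IntegrableOn (fun v : ℝ => auxF lam v) (Ioi 0) := by
  have h := integrableOn_exp_mul_Ioi (a := -√2) (by simp) 0
  refine Integrable.mono' h ?_ ?_
  · exact ((auxF_differentiable lam).continuous.comp
      Complex.continuous_ofReal).aestronglyMeasurable
  · refine Eventually.of_forall fun x => ?_
    rw [auxF_norm]
    simp

lemma aux_rotate (lam σ c : ℝ) (hσ : |σ| = 1) (hc : 0 < c)
    (hb : ∀ R t : ℝ, 1 ≤ R → 0 ≤ t → t ≤ R →
      -2 * lam * R * (σ * t) - √2 * (R - σ * t) ≤ -c * R)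
    (hint : IntegrableOn (fun w : ℝ => auxF lam ((1 + σ * Complex.I) * w)) (Ioi 0)) :
    ∫ v in Ioi (0 : ℝ), auxF lam v =
      ∫ w in Ioi (0 : ℝ), (1 + σ * Complex.I) * auxF lam ((1 + σ * Complex.I) * w) := by
  obtain ⟨Φ, hΦ⟩ := (auxF_differentiable lam).isExactOn_univ
  have hΦ' : ∀ z, HasDerivAt Φ (auxF lam z) z := fun z => hΦ z (mem_univ z)
  have key : ∀ (a : ℂ) (R : ℝ), ∫ w in (0 : ℝ)..R, a * auxF lam (a * w) = Φ (a * R) - Φ 0 := by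
    intro a R
    have := intervalIntegral.integral_eq_sub_of_hasDerivAt (a := 0) (b := R)
      (f := fun w : ℝ => Φ (a * w)) (f' := fun w : ℝ => a * auxF lam (a * w)) ?_ ?_
    · simpa using this
    · intro x _
      have h1 : HasDerivAt (fun w : ℝ => a * (w : ℂ)) a x := by
        simpa using (Complex.ofRealCLM.hasDerivAt (x := x)).const_mul a
      have := (hΦ' (a * x)).comp x h1
      rwa [mul_comm] at this
    · apply Continuous.intervalIntegrable
      have := (auxF_differentiable lam).continuous
      fun_prop
  have t1 := intervalIntegral_tendsto_integral_Ioi 0 (auxF_integrableOn lam) tendsto_id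
  have t2 := intervalIntegral_tendsto_integral_Ioi 0
    (hint.const_mul (1 + σ * Complex.I)) tendsto_id
  have k1 : ∀ R : ℝ, ∫ w in (0 : ℝ)..R, auxF lam w = Φ R - Φ 0 := by
    intro R; simpa using key 1 R
  simp only [id, key, k1] at t1 t2
  have hd : Tendsto (fun R : ℝ => (Φ ((1 + σ * Complex.I) * R) - Φ 0) - (Φ R - Φ 0))
      atTop (𝓝 0) := by
    have hlim : Tendsto (fun R : ℝ => Real.exp (-c * R) * R) atTop (𝓝 0) := by
      have := Real.tendsto_pow_mul_exp_neg_atTop_nhds_zero 1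
      have h2 := (this.comp (tendsto_id.const_mul_atTop hc)).const_mul (c⁻¹)
      simp only [mul_zero] at h2
      refine h2.congr fun R => ?_
      simp
      field_simp
    refine squeeze_zero_norm' ?_ hlim
    filter_upwards [eventually_ge_atTop 1] with R hR
    have hR0 : 0 ≤ R := by linarith
    rw [sub_sub_sub_cancel_right]
    have hx : ∀ t ∈ Icc (0 : ℝ) R, HasDerivWithinAt (fun t : ℝ => Φ (R + t * (σ * Complex.I)))
        (auxF lam (R + t * (σ * Complex.I)) * (σ * Complex.I)) (Icc 0 R) t := by
      intro t _
      have h1 : HasDerivAt (fun w : ℝ => (R : ℂ) + (w : ℂ) * (σ * Complex.I)) (σ * Complex.I) t := by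
        simpa using ((Complex.ofRealCLM.hasDerivAt (x := t)).mul_const (σ * Complex.I)).const_add
          (R : ℂ)
      exact ((hΦ' _).comp t h1).hasDerivWithinAt
    have hbd : ∀ t ∈ Icc (0 : ℝ) R,
        ‖auxF lam (R + t * (σ * Complex.I)) * (σ * Complex.I)‖ ≤ Real.exp (-c * R) := by
      intro t ht
      rw [norm_mul, norm_mul, Complex.norm_I, Complex.norm_real, Real.norm_eq_abs, hσ, auxF_norm]
      simp only [mul_one]
      apply Real.exp_le_exp.2
      have := hb R t hR ht.1 ht.2
      simpa [mul_comm t σ] using this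
    have := Convex.norm_image_sub_le_of_norm_hasDerivWithin_le hx hbd (convex_Icc 0 R)
      (left_mem_Icc.2 hR0) (right_mem_Icc.2 hR0)
    simp only [Complex.ofReal_zero, zero_mul, add_zero, sub_zero, Real.norm_eq_abs,
      abs_of_nonneg hR0] at this
    have hz : (1 + (σ : ℂ) * Complex.I) * R = R + R * (σ * Complex.I) := by ring
    rw [hz]
    exact this
  have := tendsto_nhds_unique (t2.sub t1) hd
  exact (sub_eq_zero.1 this).symm

lemma aux_nonpos (lam : ℝ) (h : lam ≤ 0) : 0 < (∫ v in Ioi (0 : ℝ), auxF lam v).re := by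
  have hq : 0 < √2 := by positivity
  have e : ∀ w : ℝ, auxF lam ((1 + ((-1 : ℝ) : ℂ) * Complex.I) * w)
      = (Real.exp (2 * lam * w ^ 2 - 2 * √2 * w) : ℝ) := by
    intro w
    rw [auxF, Complex.ofReal_exp]
    congr 1
    push_cast
    have := Complex.I_sq
    linear_combination ((lam : ℂ) * Complex.I * w ^ 2 - 2 * lam * w ^ 2 + √2 * w) * this
  have hre : IntegrableOn (fun w : ℝ => Real.exp (2 * lam * w ^ 2 - 2 * √2 * w)) (Ioi 0) := by
    refine Integrable.mono' (integrableOn_exp_mul_Ioi (a := -√2) (by simp) 0) ?_ ?_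
    · exact Continuous.aestronglyMeasurable (by fun_prop)
    · filter_upwards [ae_restrict_mem measurableSet_Ioi] with w hw
      rw [Real.norm_eq_abs, Real.abs_exp]
      apply Real.exp_le_exp.2
      have hw : 0 < w := hw
      nlinarith [mul_pos hq hw, mul_nonneg (neg_nonneg.2 h) (sq_nonneg w)]
  rw [aux_rotate lam (-1) (√2) (by simp) hq]
  · simp only [e]
    rw [integral_const_mul, integral_complex_ofReal, Complex.re_mul_ofReal]
    simp only [Complex.add_re, Complex.one_re, Complex.re_ofReal_mul, Complex.I_re, mul_zero,
      add_zero, one_mul]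
    rw [setIntegral_pos_iff_support_of_nonneg_ae _ hre]
    · have : Function.support (fun w : ℝ => Real.exp (2 * lam * w ^ 2 - 2 * √2 * w)) = univ := by
        ext x; simp [(Real.exp_pos _).ne']
      simp [this]
    · exact Eventually.of_forall fun x => (Real.exp_pos _).le
  · intro R t hR h0 ht
    nlinarith [mul_nonneg (mul_nonneg (neg_nonneg.2 h) (by linarith : 0 ≤ R)) h0, mul_nonneg hq.le h0]
  · simp only [e]
    exact hre.ofReal

lemma aux_cos (b k : ℝ) (hb : 0 < b) :
    0 < ∫ w in Ioi (0 : ℝ), Real.exp (-b * w ^ 2) * Real.cos (k * w) := by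
  have h := fourierIntegral_gaussian (b := (b : ℂ)) (by simpa using hb) (k : ℂ)
  have hint := (integrable_cexp_quadratic (b := (b : ℂ)) (by simpa using hb) (Complex.I * k) 0)
  have h2 := integral_comp_abs (f := fun w : ℝ => Real.exp (-b * w ^ 2) * Real.cos (k * w))
  have h3 : ∫ w : ℝ, Real.exp (-b * |w| ^ 2) * Real.cos (k * |w|)
      = √(π / b) * Real.exp (-k ^ 2 / (4 * b)) := by
    have h4 := congrArg Complex.re h
    have h5 : ((π : ℂ) / b) ^ (1 / 2 : ℂ) = ((√(π / b) : ℝ) : ℂ) := by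
      rw [Real.sqrt_eq_rpow, Complex.ofReal_cpow (by positivity)]
      push_cast; rfl
    have h6 : Complex.exp (-(k : ℂ) ^ 2 / (4 * b)) = ((Real.exp (-k ^ 2 / (4 * b)) : ℝ) : ℂ) := by
      push_cast; rfl
    rw [h5, h6, ← Complex.ofReal_mul, Complex.ofReal_re] at h4
    rw [← h4]
    have h7 := integral_re (𝕜 := ℂ) (f := fun x : ℝ =>
      Complex.exp (Complex.I * k * x) * Complex.exp (-b * x ^ 2)) (μ := volume) ?_
    · refine Eq.trans ?_ h7
      refine integral_congr_ae (Eventually.of_forall fun x => ?_)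
      have a1 : Complex.exp (Complex.I * k * x) * Complex.exp (-b * x ^ 2)
          = ((Real.exp (-b * x ^ 2) : ℝ) : ℂ) * Complex.exp (((k * x : ℝ) : ℂ) * Complex.I) := by
        push_cast
        rw [mul_comm]; congr 2; ring
      have a2 : Real.cos (k * |x|) = Real.cos (k * x) := by
        rcases abs_choice x with h | h <;> rw [h]
        rw [mul_neg, Real.cos_neg]
      simp only [a1, a2, sq_abs]
      rw [RCLike.re_eq_complex_re, Complex.re_ofReal_mul, Complex.exp_ofReal_mul_I_re]
    · refine hint.congr (Eventually.of_forall fun x => ?_)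
      simp only [← Complex.exp_add]
      congr 1; ring
  rw [h3] at h2
  have : 0 < √(π / b) * Real.exp (-k ^ 2 / (4 * b)) := by positivity
  linarith

lemma aux_sin (b k : ℝ) (hb : 0 < b) (hk : 0 < k) :
    0 ≤ ∫ w in Ioi (0 : ℝ), Real.exp (-b * w ^ 2) * Real.sin (k * w) := by
  have i1 : IntegrableOn (fun w : ℝ => Real.exp (-b * w ^ 2) * Real.sin (k * w)) (Ioi 0) := by
    refine Integrable.mono' (integrable_exp_neg_mul_sq hb).integrableOn
      (Continuous.aestronglyMeasurable (by fun_prop)) (Eventually.of_forall fun x => ?_)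
    rw [norm_mul, Real.norm_eq_abs, Real.abs_exp]
    exact mul_le_of_le_one_right (Real.exp_pos _).le (Real.abs_sin_le_one _)
  have i2 : IntegrableOn (fun w : ℝ => w * Real.exp (-b * w ^ 2) * (1 - Real.cos (k * w)))
      (Ioi 0) := by
    refine Integrable.mono' ((integrable_mul_exp_neg_mul_sq hb).norm.mul_const 2).integrableOn
      (Continuous.aestronglyMeasurable (by fun_prop)) (Eventually.of_forall fun x => ?_)
    rw [norm_mul]
    refine mul_le_mul_of_nonneg_left ?_ (norm_nonneg _)
    rw [Real.norm_eq_abs, abs_le]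
    constructor <;> linarith [Real.cos_le_one (k * x), Real.neg_one_le_cos (k * x)]
  have hz := integral_Ioi_of_hasDerivAt_of_tendsto' (a := 0) (m := (0 : ℝ))
    (f := fun w : ℝ => Real.exp (-b * w ^ 2) * (1 - Real.cos (k * w)))
    (f' := fun w : ℝ => k * (Real.exp (-b * w ^ 2) * Real.sin (k * w))
      - 2 * b * (w * Real.exp (-b * w ^ 2) * (1 - Real.cos (k * w)))) ?_ ?_ ?_
  · rw [integral_sub (i1.const_mul k) (i2.const_mul (2 * b)), integral_const_mul,
      integral_const_mul] at hz
    simp only [mul_zero, Real.cos_zero, sub_self] at hz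
    have : 0 ≤ ∫ w in Ioi (0 : ℝ), w * Real.exp (-b * w ^ 2) * (1 - Real.cos (k * w)) := by
      refine setIntegral_nonneg measurableSet_Ioi fun w hw => ?_
      have hw : 0 < w := hw
      have := Real.cos_le_one (k * w)
      have : 0 ≤ 1 - Real.cos (k * w) := by linarith
      positivity
    have h3 : 0 ≤ k * ∫ w in Ioi (0 : ℝ), Real.exp (-b * w ^ 2) * Real.sin (k * w) := by
      have := mul_nonneg (by positivity : 0 ≤ 2 * b) this
      linarith
    exact nonneg_of_mul_nonneg_right h3 hk
  · intro x _
    have h1 : HasDerivAt (fun w : ℝ => Real.exp (-b * w ^ 2))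
        (Real.exp (-b * x ^ 2) * (-b * (2 * x))) x := by
      have := ((hasDerivAt_pow 2 x).const_mul (-b)).exp
      simpa using this
    have h2 : HasDerivAt (fun w : ℝ => 1 - Real.cos (k * w)) (Real.sin (k * x) * k) x := by
      have := (((hasDerivAt_id x).const_mul k).cos).const_sub 1
      simpa using this
    refine (h1.mul h2).congr_deriv ?_
    ring
  · exact (i1.const_mul k).sub (i2.const_mul (2 * b))
  · have hl : Tendsto (fun w : ℝ => Real.exp (-b * w ^ 2) * 2) atTop (𝓝 0) := by
      rw [show (0 : ℝ) = 0 * 2 by simp]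
      refine Tendsto.mul_const 2 (Real.tendsto_exp_atBot.comp ?_)
      exact (tendsto_pow_atTop two_ne_zero).const_mul_atTop_of_neg (by linarith)
    refine squeeze_zero (fun w => ?_) (fun w => ?_) hl
    · exact mul_nonneg (Real.exp_pos _).le (by linarith [Real.cos_le_one (k * w)])
    · exact mul_le_mul_of_nonneg_left (by linarith [Real.neg_one_le_cos (k * w)])
        (Real.exp_pos _).le

lemma aux_pos (lam : ℝ) (h : 0 < lam) : 0 < (∫ v in Ioi (0 : ℝ), auxF lam v).re := by
  have hq : 0 < √2 := by positivity
  have hb : 0 < 2 * lam := by positivity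
  have e : ∀ w : ℝ, auxF lam ((1 + ((1 : ℝ) : ℂ) * Complex.I) * w)
      = Complex.exp (-((2 * lam : ℝ) : ℂ) * w ^ 2 + (-(2 * √2 : ℝ) * Complex.I) * w + 0) := by
    intro w
    rw [auxF]
    congr 1
    push_cast
    have := Complex.I_sq
    linear_combination ((lam : ℂ) * Complex.I * w ^ 2 + 2 * lam * w ^ 2 - √2 * w) * this
  have hint : IntegrableOn (fun w : ℝ => auxF lam ((1 + ((1 : ℝ) : ℂ) * Complex.I) * w))
      (Ioi 0) := by
    simp only [e]
    exact (integrable_cexp_quadratic (by simpa using h) _ _).integrableOn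
  rw [aux_rotate lam 1 (min (2 * lam) (√2)) (by simp) (lt_min hb hq) _ hint]
  · have h7 := integral_re (𝕜 := ℂ) (hint.const_mul (1 + ((1 : ℝ) : ℂ) * Complex.I))
    rw [← RCLike.re_eq_complex_re, ← h7]
    have e2 : ∀ w : ℝ, RCLike.re ((1 + ((1 : ℝ) : ℂ) * Complex.I) *
        auxF lam ((1 + ((1 : ℝ) : ℂ) * Complex.I) * w)) =
        Real.exp (-(2 * lam) * w ^ 2) * Real.cos (2 * √2 * w)
        + Real.exp (-(2 * lam) * w ^ 2) * Real.sin (2 * √2 * w) := by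
      intro w
      have a1 : Complex.exp (-((2 * lam : ℝ) : ℂ) * w ^ 2 + (-(2 * √2 : ℝ) * Complex.I) * w + 0)
          = ((Real.exp (-(2 * lam) * w ^ 2) : ℝ) : ℂ)
            * Complex.exp (((-(2 * √2 * w) : ℝ) : ℂ) * Complex.I) := by
        rw [Complex.ofReal_exp, ← Complex.exp_add]
        congr 1; push_cast; ring
      rw [e, a1, RCLike.re_eq_complex_re, mul_left_comm, Complex.re_ofReal_mul, Complex.mul_re,
        Complex.exp_ofReal_mul_I_re, Complex.exp_ofReal_mul_I_im, Real.cos_neg, Real.sin_neg]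
      simp
      ring
    simp only [e2]
    have ie := (integrable_exp_neg_mul_sq hb).integrableOn (s := Ioi 0)
    rw [integral_add]
    · linarith [aux_cos (2 * lam) (2 * √2) hb, aux_sin (2 * lam) (2 * √2) hb (by positivity)]
    · refine Integrable.mono' ie
        (Continuous.aestronglyMeasurable (by fun_prop)) (Eventually.of_forall fun x => ?_)
      rw [norm_mul, Real.norm_eq_abs, Real.abs_exp]
      exact mul_le_of_le_one_right (Real.exp_pos _).le (Real.abs_cos_le_one _)
    · refine Integrable.mono' ie
        (Continuous.aestronglyMeasurable (by fun_prop)) (Eventually.of_forall fun x => ?_)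
      rw [norm_mul, Real.norm_eq_abs, Real.abs_exp]
      exact mul_le_of_le_one_right (Real.exp_pos _).le (Real.abs_sin_le_one _)
  · intro R t hR h0 ht
    have m1 := min_le_left (2 * lam) (√2)
    have m2 := min_le_right (2 * lam) (√2)
    nlinarith [mul_nonneg (sub_nonneg.2 m1) h0, mul_nonneg (sub_nonneg.2 m2) (sub_nonneg.2 ht),
      mul_nonneg (mul_nonneg h.le h0) (sub_nonneg.2 hR)]

/-- The kernel. -/
def auxG (lam : ℝ) (u : ℝ) : ℂ :=
  Complex.exp (Complex.I * u * lam) *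
    Complex.exp (-2 * Complex.exp (Complex.I * Real.sign u * Real.pi / 4) *
      Real.sqrt |u|) / (Real.sqrt |u| : ℂ)

lemma aux_exp : Complex.exp (Complex.I * π / 4) = (√2 : ℝ) / 2 * (1 + Complex.I) := by
  have : Complex.I * π / 4 = ((π / 4 : ℝ) : ℂ) * Complex.I := by push_cast; ring
  rw [this, Complex.exp_mul_I, ← Complex.ofReal_cos, ← Complex.ofReal_sin, Real.cos_pi_div_four,
    Real.sin_pi_div_four]
  push_cast; ring

lemma auxG_sq (lam x : ℝ) (hx : 0 < x) :
    (|(2 : ℝ)| * x ^ ((2 : ℝ) - 1)) • auxG lam (x ^ (2 : ℝ)) = 2 * auxF lam x := by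
  have hx0 : (x : ℂ) ≠ 0 := by exact_mod_cast hx.ne'
  have h2 : x ^ (2 : ℝ) = x ^ 2 := by exact_mod_cast Real.rpow_natCast x 2
  have h1 : x ^ ((2 : ℝ) - 1) = x := by norm_num
  rw [h1, h2, auxG, Real.sign_of_pos (by positivity), abs_of_pos (by positivity : 0 < x ^ 2),
    Real.sqrt_sq hx.le, Complex.real_smul]
  simp only [Complex.ofReal_one, mul_one]
  rw [aux_exp, auxF, ← Complex.exp_add, abs_of_pos (by norm_num : (0 : ℝ) < 2)]
  push_cast
  rw [mul_assoc, mul_div_cancel₀ _ hx0]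
  congr 2
  ring

lemma auxG_neg (lam u : ℝ) : auxG lam (-u) = (starRingEnd ℂ) (auxG lam u) := by
  simp only [auxG, map_div₀, map_mul, ← Complex.exp_conj, Complex.conj_ofReal, Complex.conj_I,
    abs_neg, Real.sign_neg, map_neg, Complex.ofReal_neg, map_ofNat]
  have a : Complex.I * -(u : ℂ) * lam = -Complex.I * u * lam := by ring
  have b : Complex.I * -(Real.sign u : ℂ) * π / 4 = -Complex.I * Real.sign u * π / 4 := by ring
  rw [a, b]

lemma auxG_intOn (lam : ℝ) : IntegrableOn (auxG lam) (Ioi 0) := by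
  rw [← integrableOn_Ioi_comp_rpow_iff (auxG lam) (two_ne_zero' ℝ)]
  refine IntegrableOn.congr_fun ((auxF_integrableOn lam).const_mul 2) ?_ measurableSet_Ioi
  intro x hx
  exact (auxG_sq lam x hx).symm

lemma auxG_intOn_neg (lam : ℝ) : IntegrableOn (auxG lam) (Iic 0) := by
  rw [integrableOn_Iic_iff_integrableOn_Iio]
  have h : IntegrableOn (fun u => (starRingEnd ℂ) (auxG lam u)) (Ioi (-0)) := by
    rw [neg_zero]
    exact (Complex.conjCLE.toContinuousLinearMap.integrable_comp (auxG_intOn lam))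
  refine h.comp_neg_Iio.congr_fun ?_ measurableSet_Iio
  intro x _
  simp only [← auxG_neg, neg_neg]

lemma auxG_main (lam : ℝ) : Integrable (auxG lam) ∧ ∫ u, auxG lam u ≠ 0 := by
  have hi : Integrable (auxG lam) := by
    rw [← integrableOn_univ, ← Iic_union_Ioi (a := (0 : ℝ))]
    exact (auxG_intOn_neg lam).union (auxG_intOn lam)
  refine ⟨hi, ?_⟩
  have hJ : 0 < (∫ v in Ioi (0 : ℝ), auxF lam v).re := by
    rcases le_or_gt lam 0 with h | h
    · exact aux_nonpos lam h
    · exact aux_pos lam h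
  have h1 : ∫ u in Ioi 0, auxG lam u = 2 * ∫ v in Ioi (0 : ℝ), auxF lam v := by
    rw [← integral_comp_rpow_Ioi (auxG lam) (two_ne_zero' ℝ), ← integral_const_mul]
    exact setIntegral_congr_fun measurableSet_Ioi fun x hx => auxG_sq lam x hx
  have h2 : ∫ u in Iic 0, auxG lam u = (starRingEnd ℂ) (∫ u in Ioi 0, auxG lam u) := by
    rw [← integral_conj]
    have := integral_comp_neg_Ioi 0 (auxG lam)
    rw [neg_zero] at this
    rw [← this]
    simp only [auxG_neg]
  rw [← intervalIntegral.integral_Iic_add_Ioi hi.integrableOn hi.integrableOn (b := 0), h2, h1]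
  intro h0
  have := congrArg Complex.re h0
  simp at this
  linarith

/-- The scaling-limit kernel `u ↦ e^{iuλ} exp(-2 e^{i·sgn(u)·π/4} √|u|)/√|u|` is
Lebesgue integrable on ℝ and its integral `s(λ)` is nonzero. -/
theorem scaling_kernel_integrable_and_integral_ne_zero (lam : ℝ) :
    Integrable (fun u : ℝ =>
        Complex.exp (Complex.I * u * lam) *
          Complex.exp (-2 * Complex.exp (Complex.I * Real.sign u * Real.pi / 4) *
            Real.sqrt |u|) / (Real.sqrt |u| : ℂ)) ∧
      (∫ u : ℝ,
          Complex.exp (Complex.I * u * lam) *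
            Complex.exp (-2 * Complex.exp (Complex.I * Real.sign u * Real.pi / 4) *
              Real.sqrt |u|) / (Real.sqrt |u| : ℂ)) ≠ 0 := by
  exact auxG_main lam
end
end
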